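/- Let n, k ∈ ℕ, p ∈ [1,∞), γ ∈ Γ_{p,1}, s ∈ (0,1), and set q := 1/s. Then there exists a constant C > 0 such that for every locally integrable f : ℝ^n → ℝ having weak derivatives of orders k−1 and k with |∇^{k−1} f| ∈ L^∞(ℝ^n) and |∇^k f| ∈ L^p(ℝ^n), sup_{λ∈(0,∞)} λ (∫_{ℝ^n}[∫_{ℝ^n} 1_{E_{λ,γ/q+s−1,k}[f]}(x,h) |h|^{γ−n} dh]^{p} dx)^{1/(pq)} ≤ C ‖|∇^{k−1} f|‖_{L^∞}^{1−s} ‖|∇^k f|‖_{L^p}^{s}. -/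

import Mathlib

open MeasureTheory Filter Set
open scoped ENNReal NNReal BigOperators Topology Classical

noncomputable section

/-- `ℝ^n`. -/
abbrev En (n : ℕ) := EuclideanSpace ℝ (Fin n)

variable {n : ℕ}

/-- The `k`-th order difference `Δ_h^k f (x) = ∑_{j=0}^k (-1)^{k-j} C(k,j) f (x + j h)`. -/
def kDiff (k : ℕ) (f : En n → ℝ) (h x : En n) : ℝ :=
  ∑ j ∈ Finset.range (k + 1), (-1 : ℝ) ^ (k - j) * (k.choose j : ℝ) * f (x + (j : ℝ) • h)

/-- Membership of `(x,h)` in `E_{λ,b,k,ℓ}[f]`. -/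
def memE (k ℓ : ℕ) (lam b : ℝ) (f : En n → ℝ) (x h : En n) : Prop :=
  h ≠ 0 ∧ lam * ‖h‖ ^ ((ℓ : ℝ) + b) < |kDiff k f h x|

/-- `∫_{ℝ^n} 1_{E_{λ,b,k,ℓ}[f]}(x,h) |h|^{γ-n} dh`. -/
def innerInt (k ℓ : ℕ) (lam b γ : ℝ) (f : En n → ℝ) (x : En n) : ℝ≥0∞ :=
  ∫⁻ h, if memE k ℓ lam b f x h then ENNReal.ofReal (‖h‖ ^ (γ - (n : ℝ))) else 0

/-- `λ (∫_{ℝ^n} (∫_{ℝ^n} 1_E |h|^{γ-n} dh)^{p/q} dx)^{1/p}`. -/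
def bsvy (k ℓ : ℕ) (p q b γ : ℝ) (f : En n → ℝ) (lam : ℝ) : ℝ≥0∞ :=
  ENNReal.ofReal lam * (∫⁻ x, (innerInt k ℓ lam b γ f x) ^ (p / q)) ^ (1 / p)

/-- First-order partial derivative in the `i`-th coordinate direction. -/
def pd (i : Fin n) (ψ : En n → ℝ) : En n → ℝ :=
  fun x => fderiv ℝ ψ x (EuclideanSpace.single i (1 : ℝ))

/-- Higher-order partial derivative `∂^α` associated with a multi-index `α`. -/
def mpd (α : Fin n → ℕ) (φ : En n → ℝ) : En n → ℝ :=
  (List.finRange n).foldr (fun i ψ => (pd i)^[α i] ψ) φ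

/-- `g` is the family of `m`-th order weak partial derivatives of `f`. -/
def HasWeakDerivs (m : ℕ) (f : En n → ℝ) (g : (Fin n → ℕ) → En n → ℝ) : Prop :=
  (∀ α : Fin n → ℕ, (∑ i, α i) = m → LocallyIntegrable (g α) volume) ∧
  ∀ α : Fin n → ℕ, (∑ i, α i) = m →
    ∀ φ : En n → ℝ, ContDiff ℝ (⊤ : ℕ∞) φ → HasCompactSupport φ →
      ∫ x, f x * mpd α φ x = (-1 : ℝ) ^ m * ∫ x, g α x * φ x

/-- `|∇^m f| = (∑_{|α| = m} |∂^α f|^2)^{1/2}`, given the family `g` of weak derivatives. -/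
def gradLen (m : ℕ) (g : (Fin n → ℕ) → En n → ℝ) (x : En n) : ℝ :=
  Real.sqrt (∑' α : Fin n → ℕ, if (∑ i, α i) = m then (g α x) ^ 2 else 0)

/-- The parameter range `Γ_{p,q}`. -/
def Gam (p q : ℝ) : Set ℝ := if p = 1 then Iio (-q) ∪ Ioi 0 else {(0 : ℝ)}ᶜ

/-- `‖ |∇^m f| ‖_{L^p}` as an `ℝ≥0∞`-valued quantity. -/
def gradLp (p : ℝ) (m : ℕ) (g : (Fin n → ℕ) → En n → ℝ) : ℝ≥0∞ :=
  (∫⁻ x, ENNReal.ofReal (gradLen m g x ^ p)) ^ (1 / p)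

end

open MeasureTheory Set
open scoped ENNReal

theorem exists_countable_interval_cover (F : ℝ → ℝ≥0∞) (hF : ∫⁻ t, F t ≠ ⊤) {μ κ : ℝ} (β : ℝ)
    (hμ : 0 < μ) (hκ : 0 < κ) :
    ∃ u : Set (ℝ × ℝ), u.Countable ∧ (∀ b ∈ u, 0 < b.2) ∧
      ∑' b : u, ENNReal.ofReal (μ * b.1.2 ^ β) ≤ ∫⁻ t, F t ∧
      ∀ x r, 0 < r → ENNReal.ofReal (μ * r ^ β) < ∫⁻ t in Icc x (x + κ * r), F t →
        ∃ b ∈ u, |x - b.1| ≤ κ * max r b.2 ∧ r ^ β ≤ 2 * b.2 ^ β := by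
  let B : ℝ × ℝ → Set ℝ := fun a => Icc a.1 (a.1 + κ * a.2)
  let t : Set (ℝ × ℝ) := {a | 0 < a.2 ∧ ENNReal.ofReal (μ * a.2 ^ β) < ∫⁻ y in B a, F y}
  obtain ⟨u, hut, hdisj, hcov⟩ := Vitali.exists_disjoint_subfamily_covering_enlargement B t
    (fun a => a.2 ^ β) 2 one_lt_two (fun a ha => Real.rpow_nonneg ha.1.le _)
    ((∫⁻ y, F y).toReal / μ) (by
      rintro a ⟨ha, h⟩
      rw [le_div_iff₀ hμ, mul_comm]
      have := h.trans_le (setLIntegral_le_lintegral (B a) F)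
      exact ((ENNReal.ofReal_lt_iff_lt_toReal (by positivity) hF).1 this).le)
    (by
      rintro a ⟨ha, -⟩
      exact nonempty_Icc.2 (by nlinarith [mul_pos hκ ha]))
  have hcount : u.Countable := hdisj.countable_of_nonempty_interior (by
    intro a ha
    have := (hut ha).1
    simp only [B, interior_Icc]
    exact nonempty_Ioo.2 (by nlinarith [mul_pos hκ this]))
  refine ⟨u, hcount, fun b hb => (hut hb).1, ?_, ?_⟩
  · calc ∑' b : u, ENNReal.ofReal (μ * b.1.2 ^ β)
        ≤ ∑' b : u, ∫⁻ y in B b, F y := ENNReal.tsum_le_tsum fun b => (hut b.2).2.le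
      _ = ∫⁻ y in ⋃ b ∈ u, B b, F y :=
          (lintegral_biUnion hcount (fun _ _ => measurableSet_Icc) hdisj _).symm
      _ ≤ ∫⁻ y, F y := setLIntegral_le_lintegral _ _
  · intro x r hr h
    obtain ⟨b, hbu, ⟨y, ⟨hy1, hy2⟩, hy3, hy4⟩, hb⟩ := hcov (x, r) ⟨hr, h⟩
    refine ⟨b, hbu, ?_, hb⟩
    simp only at hy1 hy2 hy3 hy4
    have h1 : κ * r ≤ κ * max r b.2 := by gcongr; exact le_max_left _ _
    have h2 : κ * b.2 ≤ κ * max r b.2 := by gcongr; exact le_max_right _ _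
    rw [abs_le]
    constructor <;> linarith

theorem setLIntegral_Ioc_rpow {γ a : ℝ} (hγ : 0 < γ) (ha : 0 ≤ a) :
    ∫⁻ r in Ioc 0 a, ENNReal.ofReal (r ^ (γ - 1)) = ENNReal.ofReal (a ^ γ / γ) := by
  have hint : IntervalIntegrable (fun r : ℝ => r ^ (γ - 1)) volume 0 a :=
    intervalIntegral.intervalIntegrable_rpow' (by linarith)
  rw [← ofReal_integral_eq_lintegral_ofReal
    ((intervalIntegrable_iff_integrableOn_Ioc_of_le ha).1 hint), ← intervalIntegral.integral_of_le ha,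
    integral_rpow (Or.inl (by linarith))]
  · simp [Real.zero_rpow hγ.ne']
  · filter_upwards [ae_restrict_mem measurableSet_Ioc] with r hr
    exact Real.rpow_nonneg hr.1.le _

theorem setLIntegral_Ioi_rpow {γ a : ℝ} (hγ : γ < 0) (ha : 0 < a) :
    ∫⁻ r in Ioi a, ENNReal.ofReal (r ^ (γ - 1)) = ENNReal.ofReal (a ^ γ / -γ) := by
  rw [← ofReal_integral_eq_lintegral_ofReal (integrableOn_Ioi_rpow_of_lt (by linarith) ha),
    integral_Ioi_rpow_of_lt (by linarith) ha]
  · congr 1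
    rw [sub_add_cancel, neg_div, div_neg]
  · filter_upwards [ae_restrict_mem measurableSet_Ioi] with r hr
    exact Real.rpow_nonneg (ha.trans hr).le _

theorem lintegral_le_of_forall_mem {S T : Set ℝ} (hT : MeasurableSet T) {P : ℝ → Prop}
    [DecidablePred P] {w : ℝ → ℝ≥0∞} (hS : MeasurableSet S) (h : ∀ r ∈ S, P r → r ∈ T) :
    ∫⁻ r in S, (if P r then w r else 0) ≤ ∫⁻ r in T, w r := by
  rw [← lintegral_indicator hT, ← lintegral_indicator hS]
  refine lintegral_mono fun r => ?_
  by_cases hr : r ∈ S <;> by_cases hP : P r <;> simp [hr, hP]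
  simp [h r hr hP]

/-- The radial integral over `{r : μ r^γ < m}` is controlled by `m / μ`. -/
theorem lintegral_superlevel_rpow_le {γ μ : ℝ} (hγ : γ ≠ 0) (hμ : 0 < μ) (m : ℝ≥0∞) :
    ∫⁻ r in Ioi (0 : ℝ), (if ENNReal.ofReal (μ * r ^ γ) < m then
      ENNReal.ofReal (r ^ (γ - 1)) else 0) ≤ ENNReal.ofReal (1 / (|γ| * μ)) * m := by
  have habs : 0 < |γ| := abs_pos.2 hγ
  induction m with
  | top =>
    rw [ENNReal.mul_top (by simpa using by positivity)]
    exact le_top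
  | coe a =>
    rcases eq_or_ne a 0 with rfl | ha
    · simp
    have ha' : (0 : ℝ) < a := by positivity
    set ρ : ℝ := ((a : ℝ) / μ) ^ (1 / γ) with hρ
    have hρ0 : 0 < ρ := by positivity
    have hργ : ρ ^ γ = a / μ := by
      rw [hρ, ← Real.rpow_mul (by positivity), one_div_mul_cancel hγ, Real.rpow_one]
    have hlt : ∀ r : ℝ, 0 < r → ENNReal.ofReal (μ * r ^ γ) < (a : ℝ≥0∞) → r ^ γ < ρ ^ γ := by
      intro r hr h
      rw [← ENNReal.ofReal_coe_nnreal, ENNReal.ofReal_lt_ofReal_iff ha'] at h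
      rw [hργ, lt_div_iff₀ hμ, mul_comm]
      exact h
    have hval : ENNReal.ofReal (ρ ^ γ / |γ|) = ENNReal.ofReal (1 / (|γ| * μ)) * a := by
      rw [← ENNReal.ofReal_coe_nnreal (p := a), ← ENNReal.ofReal_mul (by positivity), hργ]
      congr 1
      field_simp
    rw [← hval]
    rcases lt_or_gt_of_ne hγ with h | h
    · rw [abs_of_neg h, ← setLIntegral_Ioi_rpow h hρ0]
      refine lintegral_le_of_forall_mem measurableSet_Ioi measurableSet_Ioi fun r hr hP => ?_
      exact (Real.rpow_lt_rpow_iff_of_neg hr hρ0 h).1 (hlt r hr hP)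
    · rw [abs_of_pos h, ← setLIntegral_Ioc_rpow h hρ0.le]
      refine lintegral_le_of_forall_mem measurableSet_Ioc measurableSet_Ioi fun r hr hP => ?_
      exact ⟨hr, ((Real.rpow_lt_rpow_iff (le_of_lt hr) hρ0.le h).1 (hlt r hr hP)).le⟩

theorem le_lintegral_layer {β : ℝ} (hβ : 0 < β) (a : ℝ≥0∞) :
    a ^ β ≤ ENNReal.ofReal β * ∫⁻ t in Ioi (0 : ℝ),
      (if ENNReal.ofReal t < a then ENNReal.ofReal (t ^ (β - 1)) else 0) := by
  have key : ∀ b : ℝ≥0, (b : ℝ≥0∞) ≤ a → (b : ℝ≥0∞) ^ β ≤ ENNReal.ofReal β *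
      ∫⁻ t in Ioi (0 : ℝ), (if ENNReal.ofReal t < a then ENNReal.ofReal (t ^ (β - 1)) else 0) := by
    intro b hb
    calc (b : ℝ≥0∞) ^ β = ENNReal.ofReal β * ENNReal.ofReal ((b : ℝ) ^ β / β) := by
          rw [← ENNReal.ofReal_mul hβ.le, mul_div_cancel₀ _ hβ.ne',
            ← ENNReal.ofReal_rpow_of_nonneg b.coe_nonneg hβ.le, ENNReal.ofReal_coe_nnreal]
      _ = ENNReal.ofReal β * ∫⁻ t in Ioo (0 : ℝ) b, ENNReal.ofReal (t ^ (β - 1)) := by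
          rw [← setLIntegral_Ioc_rpow hβ b.coe_nonneg, setLIntegral_congr Ioo_ae_eq_Ioc]
      _ ≤ _ := by
          refine mul_le_mul' le_rfl ?_
          rw [← lintegral_indicator measurableSet_Ioo, ← lintegral_indicator measurableSet_Ioi]
          refine lintegral_mono fun t => ?_
          by_cases ht : t ∈ Ioo (0 : ℝ) b
          · have h1 : ENNReal.ofReal t < a := by
              refine lt_of_lt_of_le ?_ hb
              rw [← ENNReal.ofReal_coe_nnreal]
              exact (ENNReal.ofReal_lt_ofReal_iff (ht.1.trans ht.2)).2 ht.2
            simp [ht, h1, indicator, ht.1]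
          · simp [ht]
  induction a with
  | top =>
    refine ENNReal.le_of_forall_nnreal_lt fun r hr => ?_
    refine le_trans ?_ (key (r ^ (1 / β)) le_top)
    rw [← ENNReal.coe_rpow_of_nonneg _ hβ.le, ← NNReal.rpow_mul, one_div_mul_cancel hβ.ne',
      NNReal.rpow_one]
  | coe a => exact key a le_rfl

theorem volume_exists_lt_setLIntegral_le (F : ℝ → ℝ≥0∞) {κ t : ℝ} (hκ : 0 < κ) (ht : 0 < t) :
    volume {x | ∃ r, 0 < r ∧ ENNReal.ofReal (t * r) < ∫⁻ y in Icc x (x + κ * r), F y} ≤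
      ENNReal.ofReal (4 * κ / t) * ∫⁻ y, F y := by
  rcases eq_or_ne (∫⁻ y, F y) ⊤ with hF | hF
  · rw [hF, ENNReal.mul_top (by simpa using by positivity)]
    exact le_top
  obtain ⟨u, hu, hpos, hsum, hcov⟩ := exists_countable_interval_cover F hF 1 ht hκ
  simp only [Real.rpow_one] at hsum hcov
  have hsub : {x | ∃ r, 0 < r ∧ ENNReal.ofReal (t * r) < ∫⁻ y in Icc x (x + κ * r), F y} ⊆
      ⋃ b ∈ u, Metric.closedBall b.1 (2 * κ * b.2) := by
    rintro x ⟨r, hr, h⟩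
    obtain ⟨b, hb, h1, h2⟩ := hcov x r hr h
    refine mem_biUnion hb ?_
    rw [Metric.mem_closedBall, Real.dist_eq]
    have := hpos b hb
    have h3 : κ * max r b.2 ≤ κ * (2 * b.2) := by gcongr; exact max_le h2 (by linarith)
    linarith
  calc _ ≤ volume (⋃ b ∈ u, Metric.closedBall b.1 (2 * κ * b.2)) := measure_mono hsub
    _ ≤ ∑' b : u, volume (Metric.closedBall b.1.1 (2 * κ * b.1.2)) := measure_biUnion_le _ hu _
    _ = ∑' b : u, ENNReal.ofReal (4 * κ / t) * ENNReal.ofReal (t * b.1.2) := by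
        refine tsum_congr fun b => ?_
        rw [Real.volume_closedBall, ← ENNReal.ofReal_mul (by positivity)]
        congr 1
        field_simp
        ring
    _ = ENNReal.ofReal (4 * κ / t) * ∑' b : u, ENNReal.ofReal (t * b.1.2) := ENNReal.tsum_mul_left
    _ ≤ _ := by gcongr

theorem volume_exists_lt_setLIntegral_le_truncated (F : ℝ → ℝ≥0∞) {κ t : ℝ}
    (hκ : 0 < κ) (ht : 0 < t) :
    volume {x | ∃ r, 0 < r ∧ ENNReal.ofReal (t * r) < ∫⁻ y in Icc x (x + κ * r), F y} ≤
      ENNReal.ofReal (8 * κ / t) * ∫⁻ y, (if ENNReal.ofReal (t / (2 * κ)) < F y then F y else 0) := by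
  have hc : 8 * κ / t = 4 * κ / (t / 2) := by field_simp; norm_num
  rw [hc]
  refine le_trans (measure_mono ?_) (volume_exists_lt_setLIntegral_le _ hκ (half_pos ht))
  rintro x ⟨r, hr, h⟩
  refine ⟨r, hr, ?_⟩
  have hle : ∫⁻ y in Icc x (x + κ * r), F y ≤ ENNReal.ofReal (t / 2 * r) +
      ∫⁻ y in Icc x (x + κ * r), (if ENNReal.ofReal (t / (2 * κ)) < F y then F y else 0) := by
    calc ∫⁻ y in Icc x (x + κ * r), F y ≤ ∫⁻ y in Icc x (x + κ * r),
          (ENNReal.ofReal (t / (2 * κ)) +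
            (if ENNReal.ofReal (t / (2 * κ)) < F y then F y else 0)) := by
          refine lintegral_mono fun y => ?_
          dsimp only
          split_ifs with h
          · exact le_add_self
          · simpa using h
      _ = _ := by
          rw [lintegral_add_left measurable_const, setLIntegral_const, Real.volume_Icc,
            ← ENNReal.ofReal_mul (by positivity)]
          congr 2
          field_simp
          ring
  have h2 : ENNReal.ofReal (t * r) = ENNReal.ofReal (t / 2 * r) + ENNReal.ofReal (t / 2 * r) := by
    rw [← ENNReal.ofReal_add (by positivity) (by positivity)]
    congr 1
    ring
  rw [h2] at h
  exact lt_of_add_lt_add_left (h.trans_le hle)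

/-- A one-sided maximal function, over windows `[x, x + κ r]` with rational `r`. -/
noncomputable def rayMax (κ : ℝ) (F : ℝ → ℝ≥0∞) (x : ℝ) : ℝ≥0∞ :=
  ⨆ r : {r : ℚ // 0 < r}, (∫⁻ y in Icc x (x + κ * (r : ℚ)), F y) / ENNReal.ofReal (r : ℚ)

theorem measurable_setLIntegral_Icc_add {F : ℝ → ℝ≥0∞} (hF : Measurable F) (a : ℝ) :
    Measurable fun x => ∫⁻ y in Icc x (x + a), F y := by
  have : (fun x => ∫⁻ y in Icc x (x + a), F y) = fun x => ∫⁻ y in Icc 0 a, F (x + y) := by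
    ext x
    have h := (measurePreserving_add_left volume x).setLIntegral_comp_preimage_emb
      (measurableEmbedding_addLeft x) F (Icc x (x + a))
    rw [← h]
    simp
  rw [this]
  exact (hF.comp (measurable_fst.add measurable_snd)).lintegral_prod_right'

theorem measurable_rayMax {F : ℝ → ℝ≥0∞} (hF : Measurable F) (κ : ℝ) : Measurable (rayMax κ F) :=
  .iSup fun _ => (measurable_setLIntegral_Icc_add hF _).div_const _

theorem setLIntegral_Icc_le_rayMax {F : ℝ → ℝ≥0∞} {κ : ℝ} (hκ : 0 < κ) (x : ℝ) {r : ℝ} (hr : 0 < r) :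
    ∫⁻ y in Icc x (x + κ * r), F y ≤ 2 * rayMax κ F x * ENNReal.ofReal r := by
  obtain ⟨s, hs1, hs2⟩ := exists_rat_btwn (show r < 2 * r by linarith)
  have hs0 : (0 : ℝ) < s := hr.trans hs1
  calc ∫⁻ y in Icc x (x + κ * r), F y ≤ ∫⁻ y in Icc x (x + κ * s), F y :=
        lintegral_mono_set (Icc_subset_Icc_right (by gcongr))
    _ = (∫⁻ y in Icc x (x + κ * s), F y) / ENNReal.ofReal s * ENNReal.ofReal s :=
        (ENNReal.div_mul_cancel (by simpa using hs0) ENNReal.ofReal_ne_top).symm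
    _ ≤ rayMax κ F x * ENNReal.ofReal (2 * r) := by
        gcongr
        exact le_iSup (fun r : {r : ℚ // 0 < r} =>
          (∫⁻ y in Icc x (x + κ * (r : ℚ)), F y) / ENNReal.ofReal (r : ℚ))
          ⟨s, by exact_mod_cast hs0⟩
    _ = _ := by
        rw [ENNReal.ofReal_mul zero_le_two, ENNReal.ofReal_ofNat]
        ring

theorem lintegral_rayMax_rpow_le {κ p : ℝ} (hκ : 0 < κ) (hp : 1 < p) {F : ℝ → ℝ≥0∞}
    (hF : Measurable F) :
    ∫⁻ x, rayMax κ F x ^ p ≤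
      ENNReal.ofReal (p * (8 * κ) * (1 / ((p - 1) * (1 / (2 * κ)) ^ (p - 1)))) * ∫⁻ x, F x ^ p := by
  have hp0 : 0 < p := by linarith
  have hM := measurable_rayMax hF κ
  have hlev : ∀ t : ℝ, 0 < t → volume {x | ENNReal.ofReal t < rayMax κ F x} ≤
      ENNReal.ofReal (8 * κ / t) *
        ∫⁻ y, (if ENNReal.ofReal (t / (2 * κ)) < F y then F y else 0) := by
    intro t ht
    refine le_trans (measure_mono ?_) (volume_exists_lt_setLIntegral_le_truncated F hκ ht)
    intro x hx
    obtain ⟨⟨r, hr⟩, h⟩ := lt_iSup_iff.1 (show ENNReal.ofReal t < rayMax κ F x from hx)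
    have hr' : (0 : ℝ) < r := by exact_mod_cast hr
    refine ⟨r, hr', ?_⟩
    rwa [ENNReal.lt_div_iff_mul_lt (Or.inl (by simpa using hr')) (Or.inl ENNReal.ofReal_ne_top),
      ← ENNReal.ofReal_mul ht.le] at h
  have hm1 : Measurable fun z : ℝ × ℝ =>
      if ENNReal.ofReal z.2 < rayMax κ F z.1 then ENNReal.ofReal (z.2 ^ (p - 1)) else 0 := by
    refine Measurable.ite (measurableSet_lt (by fun_prop) (hM.comp measurable_fst)) (by fun_prop)
      measurable_const
  have hm2 : Measurable fun z : ℝ × ℝ =>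
      if ENNReal.ofReal (z.2 / (2 * κ)) < F z.1 then
        ENNReal.ofReal (8 * κ * z.2 ^ (p - 1 - 1)) * F z.1 else 0 := by
    refine Measurable.ite (measurableSet_lt (by fun_prop) (hF.comp measurable_fst)) ?_
      measurable_const
    exact Measurable.mul (by fun_prop) (hF.comp measurable_fst)
  calc ∫⁻ x, rayMax κ F x ^ p
      ≤ ∫⁻ x, ENNReal.ofReal p * ∫⁻ t in Ioi (0 : ℝ),
          (if ENNReal.ofReal t < rayMax κ F x then ENNReal.ofReal (t ^ (p - 1)) else 0) :=
        lintegral_mono fun x => le_lintegral_layer hp0 _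
    _ = ENNReal.ofReal p * ∫⁻ t in Ioi (0 : ℝ), ∫⁻ x,
          (if ENNReal.ofReal t < rayMax κ F x then ENNReal.ofReal (t ^ (p - 1)) else 0) := by
        rw [lintegral_const_mul' _ _ ENNReal.ofReal_ne_top,
          lintegral_lintegral_swap hm1.aemeasurable]
    _ ≤ ENNReal.ofReal p * ∫⁻ t in Ioi (0 : ℝ), ∫⁻ x,
          (if ENNReal.ofReal (t / (2 * κ)) < F x then
            ENNReal.ofReal (8 * κ * t ^ (p - 1 - 1)) * F x else 0) := by
        refine mul_le_mul' le_rfl (setLIntegral_mono' measurableSet_Ioi fun t ht => ?_)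
        have ht : 0 < t := ht
        calc ∫⁻ x, (if ENNReal.ofReal t < rayMax κ F x then ENNReal.ofReal (t ^ (p - 1)) else 0)
            = ENNReal.ofReal (t ^ (p - 1)) * volume {x | ENNReal.ofReal t < rayMax κ F x} := by
              rw [← lintegral_indicator_const (measurableSet_lt measurable_const hM)]
              refine lintegral_congr fun x => ?_
              simp [indicator]
          _ ≤ ENNReal.ofReal (t ^ (p - 1)) * (ENNReal.ofReal (8 * κ / t) *
                ∫⁻ y, (if ENNReal.ofReal (t / (2 * κ)) < F y then F y else 0)) := by
              gcongr
              exact hlev t ht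
          _ = ENNReal.ofReal (8 * κ * t ^ (p - 1 - 1)) *
                ∫⁻ y, (if ENNReal.ofReal (t / (2 * κ)) < F y then F y else 0) := by
              rw [← mul_assoc, ← ENNReal.ofReal_mul (by positivity), Real.rpow_sub_one ht.ne' (p - 1)]
              congr 2
              field_simp
          _ = _ := by
              rw [← lintegral_const_mul' _ _ ENNReal.ofReal_ne_top]
              simp
    _ = ENNReal.ofReal p * ∫⁻ x, ∫⁻ t in Ioi (0 : ℝ),
          (if ENNReal.ofReal (t / (2 * κ)) < F x then
            ENNReal.ofReal (8 * κ * t ^ (p - 1 - 1)) * F x else 0) := by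
        rw [lintegral_lintegral_swap]
        exact (hm2.comp measurable_swap).aemeasurable
    _ ≤ ENNReal.ofReal p * ∫⁻ x, ENNReal.ofReal (8 * κ) *
          ENNReal.ofReal (1 / ((p - 1) * (1 / (2 * κ)) ^ (p - 1))) * F x ^ p := by
        refine mul_le_mul' le_rfl (lintegral_mono fun x => ?_)
        have hrw : ∀ t ∈ Ioi (0 : ℝ), (if ENNReal.ofReal (t / (2 * κ)) < F x then
            ENNReal.ofReal (8 * κ * t ^ (p - 1 - 1)) * F x else 0) =
            (if ENNReal.ofReal ((1 / (2 * κ)) ^ (p - 1) * t ^ (p - 1)) < F x ^ (p - 1) then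
              ENNReal.ofReal (t ^ (p - 1 - 1)) else 0) * (ENNReal.ofReal (8 * κ) * F x) := by
          intro t ht
          have ht : 0 < t := ht
          have hiff : ENNReal.ofReal ((1 / (2 * κ)) ^ (p - 1) * t ^ (p - 1)) < F x ^ (p - 1) ↔
              ENNReal.ofReal (t / (2 * κ)) < F x := by
            rw [← Real.mul_rpow (by positivity) ht.le,
              ← ENNReal.ofReal_rpow_of_pos (by positivity),
              ENNReal.rpow_lt_rpow_iff (by linarith), one_div_mul_eq_div]
          simp only [hiff]
          split_ifs
          · rw [ENNReal.ofReal_mul (by positivity)]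
            ring
          · simp
        rw [setLIntegral_congr_fun measurableSet_Ioi hrw, lintegral_mul_const]
        · refine (mul_le_mul' (lintegral_superlevel_rpow_le (by linarith) (by positivity) _)
            le_rfl).trans (le_of_eq ?_)
          have hF' : F x ^ p = F x ^ (p - 1) * F x := by
            conv_rhs => rw [← ENNReal.rpow_one (F x), ← ENNReal.rpow_mul, one_mul]
            rw [← ENNReal.rpow_add_of_nonneg _ _ (by linarith) zero_le_one, sub_add_cancel]
          rw [hF', abs_of_pos (by linarith)]
          ring
        · exact Measurable.ite (measurableSet_lt (by fun_prop) measurable_const) (by fun_prop)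
            measurable_const
    _ = _ := by
        rw [lintegral_const_mul' _ _ (by finiteness), ← mul_assoc,
          ← ENNReal.ofReal_mul (by positivity), ← ENNReal.ofReal_mul (by positivity), ← mul_assoc]

/-- The radial measure of the set of radii `r` for which the average of `F` over a window of
length `κ r` starting at `x` is at least of order `μ r ^ γ`. -/
noncomputable def raySize (κ γ μ : ℝ) (F : ℝ → ℝ≥0∞) (x : ℝ) : ℝ≥0∞ :=
  ∫⁻ r in Ioi (0 : ℝ), if ENNReal.ofReal (μ * r ^ (1 + γ)) < ∫⁻ y in Icc x (x + κ * r), F y then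
    ENNReal.ofReal (r ^ (γ - 1)) else 0

theorem raySize_le_rayMax {κ γ μ : ℝ} (hκ : 0 < κ) (hγ : γ ≠ 0) (hμ : 0 < μ) (F : ℝ → ℝ≥0∞)
    (x : ℝ) :
    raySize κ γ μ F x ≤ ENNReal.ofReal (1 / (|γ| * μ)) * (2 * rayMax κ F x) := by
  refine le_trans (setLIntegral_mono' measurableSet_Ioi fun r hr => ?_)
    (lintegral_superlevel_rpow_le hγ hμ _)
  have hr : 0 < r := hr
  split_ifs with h1 h2 h2
  · exact le_rfl
  · refine absurd ?_ h2
    have h3 := h1.trans_le (setLIntegral_Icc_le_rayMax hκ x hr)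
    rw [Real.rpow_add hr, Real.rpow_one, show μ * (r * r ^ γ) = μ * r ^ γ * r by ring,
      ENNReal.ofReal_mul (by positivity)] at h3
    exact lt_of_mul_lt_mul_right' h3
  · exact zero_le
  · exact le_rfl

theorem measurable_window_weight (κ γ : ℝ) (b : ℝ × ℝ) : Measurable fun z : ℝ × ℝ =>
    if |z.1 - b.1| ≤ κ * max z.2 b.2 ∧ z.2 ^ (1 + γ) ≤ 2 * b.2 ^ (1 + γ) then
      ENNReal.ofReal (z.2 ^ (γ - 1)) else 0 := by
  have h1 : MeasurableSet {z : ℝ × ℝ | |z.1 - b.1| ≤ κ * max z.2 b.2} :=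
    measurableSet_le (by simp_rw [← Real.norm_eq_abs]; fun_prop) (by fun_prop)
  have h2 : MeasurableSet {z : ℝ × ℝ | z.2 ^ (1 + γ) ≤ 2 * b.2 ^ (1 + γ)} :=
    measurableSet_le (by fun_prop) (by fun_prop)
  exact Measurable.ite (h1.inter h2) (by fun_prop) measurable_const

/-- For a single window `b`, the size of the region of windows `(x, r)` that meet `b` and are not
much more significant than `b`. -/
theorem exists_lintegral_window_le {κ γ : ℝ} (hκ : 0 < κ) (hγ : γ < -1 ∨ 0 < γ) :
    ∃ C : ℝ, 0 < C ∧ ∀ b : ℝ × ℝ, 0 < b.2 →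
      ∫⁻ x, ∫⁻ r in Ioi (0 : ℝ),
        (if |x - b.1| ≤ κ * max r b.2 ∧ r ^ (1 + γ) ≤ 2 * b.2 ^ (1 + γ) then
          ENNReal.ofReal (r ^ (γ - 1)) else 0) ≤ ENNReal.ofReal (C * b.2 ^ (1 + γ)) := by
  have hswap : ∀ b : ℝ × ℝ, ∫⁻ x, ∫⁻ r in Ioi (0 : ℝ),
        (if |x - b.1| ≤ κ * max r b.2 ∧ r ^ (1 + γ) ≤ 2 * b.2 ^ (1 + γ) then
          ENNReal.ofReal (r ^ (γ - 1)) else 0) =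
      ∫⁻ r in Ioi (0 : ℝ), (if r ^ (1 + γ) ≤ 2 * b.2 ^ (1 + γ) then
          ENNReal.ofReal (2 * κ * max r b.2) * ENNReal.ofReal (r ^ (γ - 1)) else 0) := by
    intro b
    rw [lintegral_lintegral_swap]
    · refine setLIntegral_congr_fun measurableSet_Ioi fun r hr => ?_
      split_ifs with h
      · have : ∀ x, (if |x - b.1| ≤ κ * max r b.2 ∧ r ^ (1 + γ) ≤ 2 * b.2 ^ (1 + γ) then
            ENNReal.ofReal (r ^ (γ - 1)) else 0) =
            (Metric.closedBall b.1 (κ * max r b.2)).indicator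
              (fun _ => ENNReal.ofReal (r ^ (γ - 1))) x := by
          intro x
          simp [indicator, Real.dist_eq, h]
        simp_rw [this]
        rw [lintegral_indicator_const Metric.isClosed_closedBall.measurableSet,
          Real.volume_closedBall, mul_comm, mul_assoc 2 κ]
      · simp [h]
    · exact (measurable_window_weight κ γ b).aemeasurable
  simp_rw [hswap]
  set θ : ℝ := 2 ^ (1 / (1 + γ)) with hθ
  have hθ0 : 0 < θ := by positivity
  have hγ1 : 1 + γ ≠ 0 := by rcases hγ with h | h <;> linarith
  have hθγ : θ ^ (1 + γ) = 2 := by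
    rw [hθ, ← Real.rpow_mul zero_le_two, one_div_mul_cancel hγ1, Real.rpow_one]
  rcases hγ with h | h
  · have hθ1 : θ ≤ 1 := Real.rpow_le_one_of_one_le_of_nonpos one_le_two
      (div_nonpos_of_nonneg_of_nonpos zero_le_one (by linarith))
    refine ⟨2 * κ / θ * (2 / -(1 + γ)), by
      have : 0 < -(1 + γ) := by linarith
      positivity, fun b hb => ?_⟩
    have hθb : 0 < θ / 2 * b.2 := by positivity
    calc _ ≤ ∫⁻ r in Ioi (0 : ℝ), (if r ^ (1 + γ) ≤ 2 * b.2 ^ (1 + γ) then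
          ENNReal.ofReal (2 * κ / θ) * ENNReal.ofReal (r ^ (1 + γ - 1)) else 0) := by
          refine setLIntegral_mono' measurableSet_Ioi fun r hr => ?_
          have hr : 0 < r := hr
          split_ifs with h'
          · rw [← hθγ, ← Real.mul_rpow hθ0.le hb.le,
              Real.rpow_le_rpow_iff_of_neg hr (by positivity) (by linarith)] at h'
            have h1 : max r b.2 ≤ r / θ := by
              refine max_le ?_ ?_
              · rw [le_div_iff₀ hθ0]; nlinarith
              · rw [le_div_iff₀ hθ0]; linarith
            rw [← ENNReal.ofReal_mul (by positivity), ← ENNReal.ofReal_mul (by positivity)]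
            refine ENNReal.ofReal_le_ofReal ?_
            calc 2 * κ * max r b.2 * r ^ (γ - 1) ≤ 2 * κ * (r / θ) * r ^ (γ - 1) := by gcongr
              _ = 2 * κ / θ * r ^ (1 + γ - 1) := by
                rw [Real.rpow_sub_one hr.ne', add_sub_cancel_left]
                field_simp
          · exact le_rfl
      _ ≤ ∫⁻ r in Ici (θ * b.2),
            ENNReal.ofReal (2 * κ / θ) * ENNReal.ofReal (r ^ (1 + γ - 1)) := by
          refine lintegral_le_of_forall_mem measurableSet_Ici measurableSet_Ioi fun r hr h' => ?_
          rwa [← hθγ, ← Real.mul_rpow hθ0.le hb.le,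
              Real.rpow_le_rpow_iff_of_neg hr (by positivity) (by linarith)] at h'
      _ = ENNReal.ofReal (2 * κ / θ) * ENNReal.ofReal ((θ * b.2) ^ (1 + γ) / -(1 + γ)) := by
          rw [lintegral_const_mul' _ _ ENNReal.ofReal_ne_top, setLIntegral_congr Ioi_ae_eq_Ici.symm,
            setLIntegral_Ioi_rpow (by linarith) (by positivity)]
      _ = _ := by
          rw [← ENNReal.ofReal_mul (by positivity), Real.mul_rpow hθ0.le hb.le, hθγ]
          congr 1
          ring
  · have hθ1 : 1 ≤ θ := Real.one_le_rpow one_le_two (by positivity)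
    refine ⟨2 * κ * θ * θ ^ γ / γ, by positivity, fun b hb => ?_⟩
    calc _ ≤ ∫⁻ r in Ioc 0 (θ * b.2),
            ENNReal.ofReal (2 * κ * max r b.2) * ENNReal.ofReal (r ^ (γ - 1)) := by
          refine lintegral_le_of_forall_mem measurableSet_Ioc measurableSet_Ioi fun r hr h' => ?_
          rw [← hθγ, ← Real.mul_rpow hθ0.le hb.le,
              Real.rpow_le_rpow_iff (le_of_lt hr) (by positivity) (by linarith)] at h'
          exact ⟨hr, h'⟩
      _ ≤ ∫⁻ r in Ioc 0 (θ * b.2),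
            ENNReal.ofReal (2 * κ * (θ * b.2)) * ENNReal.ofReal (r ^ (γ - 1)) := by
          refine setLIntegral_mono' measurableSet_Ioc fun r hr => ?_
          gcongr
          exact max_le hr.2 (by nlinarith)
      _ = ENNReal.ofReal (2 * κ * (θ * b.2)) * ENNReal.ofReal ((θ * b.2) ^ γ / γ) := by
          rw [lintegral_const_mul' _ _ ENNReal.ofReal_ne_top, setLIntegral_Ioc_rpow h (by positivity)]
      _ = _ := by
          rw [← ENNReal.ofReal_mul (by positivity), Real.mul_rpow hθ0.le hb.le,
            Real.rpow_add hb, Real.rpow_one]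
          congr 1
          ring

theorem exists_lintegral_raySize_le {κ γ : ℝ} (hκ : 0 < κ) (hγ : γ < -1 ∨ 0 < γ) :
    ∃ C : ℝ, 0 < C ∧ ∀ (μ : ℝ) (F : ℝ → ℝ≥0∞), 0 < μ →
      ∫⁻ x, raySize κ γ μ F x ≤ ENNReal.ofReal (C / μ) * ∫⁻ x, F x := by
  obtain ⟨C, hC, hwin⟩ := exists_lintegral_window_le hκ hγ
  refine ⟨C, hC, fun μ F hμ => ?_⟩
  rcases eq_or_ne (∫⁻ y, F y) ⊤ with hF | hF
  · rw [hF, ENNReal.mul_top (by simpa using by positivity)]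
    exact le_top
  obtain ⟨u, hu, hpos, hsum, hcov⟩ := exists_countable_interval_cover F hF (1 + γ) hμ hκ
  have : Countable u := hu.to_subtype
  let w : u → ℝ × ℝ → ℝ≥0∞ := fun b z =>
    if |z.1 - b.1.1| ≤ κ * max z.2 b.1.2 ∧ z.2 ^ (1 + γ) ≤ 2 * b.1.2 ^ (1 + γ) then
          ENNReal.ofReal (z.2 ^ (γ - 1)) else 0
  have hw : ∀ b, Measurable (w b) := fun b => measurable_window_weight κ γ b.1
  calc ∫⁻ x, raySize κ γ μ F x ≤ ∫⁻ x, ∫⁻ r in Ioi (0 : ℝ), ∑' b : u, w b (x, r) := by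
        refine lintegral_mono fun x => setLIntegral_mono' measurableSet_Ioi fun r hr => ?_
        split_ifs with h
        · obtain ⟨b, hb, hb'⟩ := hcov x r hr h
          refine le_trans ?_ (ENNReal.le_tsum ⟨b, hb⟩)
          simp [w, hb']
        · exact zero_le
    _ = ∑' b : u, ∫⁻ x, ∫⁻ r in Ioi (0 : ℝ), w b (x, r) := by
        rw [← lintegral_tsum fun b => ((hw b).lintegral_prod_right').aemeasurable]
        refine lintegral_congr fun x => lintegral_tsum fun b => ?_
        exact ((hw b).comp measurable_prodMk_left).aemeasurable
    _ ≤ ∑' b : u, ENNReal.ofReal (C / μ) * ENNReal.ofReal (μ * b.1.2 ^ (1 + γ)) := by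
        refine ENNReal.tsum_le_tsum fun b => (hwin b.1 (hpos b.1 b.2)).trans (le_of_eq ?_)
        rw [← ENNReal.ofReal_mul (by positivity)]
        congr 1
        field_simp
    _ ≤ _ := by
        rw [ENNReal.tsum_mul_left]
        gcongr

theorem exists_lintegral_raySize_rpow_le {κ γ p : ℝ} (hκ : 0 < κ) (hp : 1 ≤ p)
    (hγ : γ ∈ Gam p 1) :
    ∃ C : ℝ, 0 < C ∧ ∀ (μ : ℝ) (F : ℝ → ℝ≥0∞), 0 < μ → Measurable F →
      ∫⁻ x, raySize κ γ μ F x ^ p ≤ ENNReal.ofReal (C / μ ^ p) * ∫⁻ x, F x ^ p := by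
  rcases hp.eq_or_lt with rfl | hp
  · simp only [Gam, if_true] at hγ
    obtain ⟨C, hC, h⟩ := exists_lintegral_raySize_le hκ hγ
    exact ⟨C, hC, fun μ F hμ _ => by simpa using h μ F hμ⟩
  · have hγ0 : γ ≠ 0 := by simpa [Gam, hp.ne'] using hγ
    have hγ' : 0 < |γ| := abs_pos.2 hγ0
    set K : ℝ := p * (8 * κ) * (1 / ((p - 1) * (1 / (2 * κ)) ^ (p - 1))) with hK
    have hK0 : 0 < K := by
      have : 0 < p - 1 := by linarith
      positivity
    refine ⟨(2 / |γ|) ^ p * K, by positivity, fun μ F hμ hF => ?_⟩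
    calc ∫⁻ x, raySize κ γ μ F x ^ p
        ≤ ∫⁻ x, ENNReal.ofReal ((2 / (|γ| * μ)) ^ p) * rayMax κ F x ^ p := by
          refine lintegral_mono fun x => ?_
          rw [← ENNReal.ofReal_rpow_of_pos (by positivity), ← ENNReal.mul_rpow_of_nonneg _ _ (by linarith)]
          refine ENNReal.rpow_le_rpow ((raySize_le_rayMax hκ hγ0 hμ F x).trans (le_of_eq ?_)) (by linarith)
          rw [← mul_assoc, ← ENNReal.ofReal_ofNat 2, ← ENNReal.ofReal_mul (by positivity)]
          congr 2
          ring
      _ = ENNReal.ofReal ((2 / (|γ| * μ)) ^ p) * ∫⁻ x, rayMax κ F x ^ p :=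
          lintegral_const_mul' _ _ ENNReal.ofReal_ne_top
      _ ≤ ENNReal.ofReal ((2 / (|γ| * μ)) ^ p) * (ENNReal.ofReal K * ∫⁻ x, F x ^ p) := by
          gcongr
          exact lintegral_rayMax_rpow_le hκ hp hF
      _ = _ := by
          rw [← mul_assoc, ← ENNReal.ofReal_mul (by positivity), ← div_div,
            Real.div_rpow (by positivity) hμ.le]
          congr 2
          ring

theorem rpow_lintegral_mul_le {α : Type*} [MeasurableSpace α] {ν : Measure α} {p : ℝ} (hp : 1 ≤ p)
    {w G : α → ℝ≥0∞} (hw : AEMeasurable w ν) (hG : AEMeasurable G ν) :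
    (∫⁻ a, w a * G a ∂ν) ^ p ≤ (∫⁻ a, w a ∂ν) ^ (p - 1) * ∫⁻ a, w a * G a ^ p ∂ν := by
  rcases hp.eq_or_lt with rfl | hp
  · simp
  have hp0 : 0 < p := by linarith
  have hq := Real.HolderConjugate.conjExponent hp
  have hq0 : 0 < p.conjExponent := hq.symm.pos
  have hsplit : ∀ a, w a * G a = (fun a => w a ^ (1 / p.conjExponent)) a *
      (fun a => w a ^ (1 / p) * G a) a := by
    intro a
    dsimp only
    rw [← mul_assoc, ← ENNReal.rpow_add_of_nonneg _ _ (by positivity) (by positivity),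
      one_div, one_div, hq.symm.inv_add_inv_eq_one, ENNReal.rpow_one]
  calc (∫⁻ a, w a * G a ∂ν) ^ p
      ≤ ((∫⁻ a, (w a ^ (1 / p.conjExponent)) ^ p.conjExponent ∂ν) ^ (1 / p.conjExponent) *
          (∫⁻ a, (w a ^ (1 / p) * G a) ^ p ∂ν) ^ (1 / p)) ^ p := by
        refine ENNReal.rpow_le_rpow ?_ hp0.le
        simp_rw [hsplit]
        exact ENNReal.lintegral_mul_le_Lp_mul_Lq ν hq.symm (hw.pow_const _)
          ((hw.pow_const _).mul hG)
    _ = _ := by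
        have h1 : 1 / p.conjExponent * p = p - 1 := by
          rw [Real.conjExponent]
          field_simp
        rw [ENNReal.mul_rpow_of_nonneg _ _ hp0.le, ← ENNReal.rpow_mul, ← ENNReal.rpow_mul, h1,
          one_div_mul_cancel hp0.ne', ENNReal.rpow_one]
        congr 2
        · refine lintegral_congr fun a => ?_
          rw [← ENNReal.rpow_mul, one_div_mul_cancel hq0.ne', ENNReal.rpow_one]
        · ext a
          rw [ENNReal.mul_rpow_of_nonneg _ _ hp0.le, ← ENNReal.rpow_mul,
            one_div_mul_cancel hp0.ne', ENNReal.rpow_one]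

/-- An integral over `ℝⁿ` as a weighted integral of integrals over lines of direction `ω`. -/
theorem lintegral_eq_lintegral_lines {n : ℕ} {ω : En n} (hω : ‖ω‖ = 1) {Ψ : En n → ℝ≥0∞}
    (hΨ : Measurable Ψ) :
    ∫⁻ x, Ψ x = ∫⁻ x, (Ico (0 : ℝ) 1).indicator 1 (inner ℝ ω x) * ∫⁻ t : ℝ, Ψ (x + t • ω) := by
  set w : ℝ → ℝ≥0∞ := (Ico (0 : ℝ) 1).indicator 1 with hw
  have hwm : Measurable w := measurable_one.indicator measurableSet_Ico
  have hin : ∀ t : ℝ, ∀ x : En n, inner ℝ ω (x - t • ω) = inner ℝ ω x - t := by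
    intro t x
    rw [inner_sub_right, inner_smul_right, real_inner_self_eq_norm_sq, hω]
    simp
  have hm1 : Measurable fun z : En n × ℝ => w (inner ℝ ω z.1) * Ψ (z.1 + z.2 • ω) :=
    (hwm.comp (by fun_prop)).mul (hΨ.comp (by fun_prop))
  have hm2 : Measurable fun z : ℝ × En n => w (inner ℝ ω z.2 - z.1) * Ψ z.2 :=
    (hwm.comp (by fun_prop)).mul (hΨ.comp (by fun_prop))
  symm
  calc ∫⁻ x, w (inner ℝ ω x) * ∫⁻ t : ℝ, Ψ (x + t • ω)
      = ∫⁻ x, ∫⁻ t : ℝ, w (inner ℝ ω x) * Ψ (x + t • ω) := by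
        refine lintegral_congr fun x => (lintegral_const_mul _ (hΨ.comp (by fun_prop))).symm
    _ = ∫⁻ t : ℝ, ∫⁻ x, w (inner ℝ ω x) * Ψ (x + t • ω) :=
        lintegral_lintegral_swap hm1.aemeasurable
    _ = ∫⁻ t : ℝ, ∫⁻ x, w (inner ℝ ω x - t) * Ψ x := by
        refine lintegral_congr fun t => ?_
        rw [← lintegral_sub_right_eq_self _ (t • ω)]
        simp [hin]
    _ = ∫⁻ x, ∫⁻ t : ℝ, w (inner ℝ ω x - t) * Ψ x := lintegral_lintegral_swap hm2.aemeasurable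
    _ = ∫⁻ x, Ψ x := by
        refine lintegral_congr fun x => ?_
        rw [lintegral_mul_const (f := fun t => w (inner ℝ ω x - t)) _ (hwm.comp (by fun_prop)),
          lintegral_sub_left_eq_self w (inner ℝ ω x), hw,
          lintegral_indicator_one measurableSet_Ico]
        simp

theorem lintegral_le_of_forall_lines {n : ℕ} {ω : En n} (hω : ‖ω‖ = 1) {Ψ Θ : En n → ℝ≥0∞}
    (hΨ : Measurable Ψ) (hΘ : Measurable Θ) {K : ℝ≥0∞} (hK : K ≠ ⊤)
    (h : ∀ x, ∫⁻ t : ℝ, Ψ (x + t • ω) ≤ K * ∫⁻ t : ℝ, Θ (x + t • ω)) :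
    ∫⁻ x, Ψ x ≤ K * ∫⁻ x, Θ x := by
  rw [lintegral_eq_lintegral_lines hω hΨ, lintegral_eq_lintegral_lines hω hΘ,
    ← lintegral_const_mul' _ _ hK]
  refine lintegral_mono fun x => ?_
  rw [mul_left_comm]
  exact mul_le_mul' le_rfl (h x)

theorem lintegral_polar {n : ℕ} (hn : 0 < n) {g : En n → ℝ≥0∞} (hg : Measurable g) :
    ∫⁻ h, g h = ∫⁻ ω : Metric.sphere (0 : En n) 1, (∫⁻ r in Ioi (0 : ℝ),
      ENNReal.ofReal (r ^ (n - 1)) * g (r • (ω : En n))) ∂(volume : Measure (En n)).toSphere := by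
  have : Nonempty (Fin n) := ⟨⟨0, hn⟩⟩
  have hmp := (volume : Measure (En n)).measurePreserving_homeomorphUnitSphereProd
  have h1 : ∫⁻ h, g h = ∫⁻ h : ({(0 : En n)}ᶜ : Set (En n)), g h ∂(volume.comap Subtype.val) := by
    rw [lintegral_subtype_comap (measurableSet_singleton _).compl, restrict_compl_singleton]
  have h2 : ∫⁻ h : ({(0 : En n)}ᶜ : Set (En n)), g h ∂(volume.comap Subtype.val) =
      ∫⁻ z, g ((z.2 : ℝ) • (z.1 : En n)) ∂((volume : Measure (En n)).toSphere.prod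
        (Measure.volumeIoiPow (Module.finrank ℝ (En n) - 1))) := by
    rw [← hmp.lintegral_comp_emb (Homeomorph.measurableEmbedding _)]
    refine lintegral_congr fun h => ?_
    have := (homeomorphUnitSphereProd (En n)).symm_apply_apply h
    conv_lhs => rw [← this, homeomorphUnitSphereProd_symm_apply_coe]
  have hmeas : Measurable fun z : Metric.sphere (0 : En n) 1 × Ioi (0 : ℝ) =>
      g ((z.2 : ℝ) • (z.1 : En n)) := hg.comp (by fun_prop)
  rw [h1, h2, lintegral_prod _ hmeas.aemeasurable, finrank_euclideanSpace_fin]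
  refine lintegral_congr fun ω => ?_
  have hm : Measurable fun r : Ioi (0 : ℝ) => g ((r : ℝ) • (ω : En n)) := hg.comp (by fun_prop)
  rw [Measure.volumeIoiPow]
  refine (lintegral_withDensity_eq_lintegral_mul _ (by fun_prop) hm).trans ?_
  exact lintegral_subtype_comap measurableSet_Ioi
    (fun r : ℝ => ENNReal.ofReal (r ^ (n - 1)) * g (r • (ω : En n)))

theorem continuous_kDiff {n : ℕ} (k : ℕ) {f : En n → ℝ} (hf : Continuous f) :
    Continuous fun z : En n × En n => kDiff k f z.2 z.1 := by
  unfold kDiff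
  fun_prop

theorem measurableSet_memE {n : ℕ} (k ℓ : ℕ) (lam b : ℝ) {f : En n → ℝ} (hf : Continuous f) :
    MeasurableSet {z : En n × En n | memE k ℓ lam b f z.1 z.2} := by
  have h1 : MeasurableSet {z : En n × En n | z.2 ≠ 0} :=
    (measurableSet_eq_fun measurable_snd measurable_const).compl
  have h2 : MeasurableSet {z : En n × En n | lam * ‖z.2‖ ^ ((ℓ : ℝ) + b) < |kDiff k f z.2 z.1|} :=
    measurableSet_lt (by fun_prop) (continuous_kDiff k hf).abs.measurable
  exact h1.inter h2

theorem measurable_memE_weight {n : ℕ} (k ℓ : ℕ) (lam b γ : ℝ) {f : En n → ℝ} (hf : Continuous f) :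
    Measurable fun z : En n × En n =>
      if memE k ℓ lam b f z.1 z.2 then ENNReal.ofReal (‖z.2‖ ^ (γ - (n : ℝ))) else 0 :=
  Measurable.ite (measurableSet_memE k ℓ lam b hf) (by fun_prop) measurable_const

theorem measurable_innerInt {n : ℕ} (k ℓ : ℕ) (lam b γ : ℝ) {f : En n → ℝ} (hf : Continuous f) :
    Measurable (innerInt k ℓ lam b γ f) :=
  (measurable_memE_weight k ℓ lam b γ hf).lintegral_prod_right'

/-- The radial part of `innerInt` in polar coordinates, in the direction `ω`. -/
noncomputable def dirSize {n : ℕ} (k : ℕ) (μ γ : ℝ) (f : En n → ℝ) (x ω : En n) : ℝ≥0∞ :=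
  ∫⁻ r in Ioi (0 : ℝ), ENNReal.ofReal (r ^ (n - 1)) *
    if memE k k μ γ f x (r • ω) then ENNReal.ofReal (‖r • ω‖ ^ (γ - (n : ℝ))) else 0

theorem measurable_dirSize {n : ℕ} (k : ℕ) (μ γ : ℝ) {f : En n → ℝ} (hf : Continuous f) :
    Measurable fun z : En n × En n => dirSize k μ γ f z.1 z.2 := by
  have h : Measurable fun y : (En n × En n) × ℝ => ENNReal.ofReal (y.2 ^ (n - 1)) *
      if memE k k μ γ f y.1.1 (y.2 • y.1.2) then
        ENNReal.ofReal (‖y.2 • y.1.2‖ ^ (γ - (n : ℝ))) else 0 := by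
    refine Measurable.mul (by fun_prop) ?_
    exact (measurable_memE_weight k k μ γ γ hf).comp
      (g := fun z : En n × En n => if memE k k μ γ f z.1 z.2 then
        ENNReal.ofReal (‖z.2‖ ^ (γ - (n : ℝ))) else 0)
      (f := fun y : (En n × En n) × ℝ => (y.1.1, y.2 • y.1.2)) (by fun_prop)
  exact h.lintegral_prod_right'

theorem dirSize_le_raySize {n k : ℕ} (hn : 0 < n) (hk : 0 < k) {μ γ c : ℝ} (hμ : 0 < μ) (hc : 0 < c)
    {f : En n → ℝ} {F : En n → ℝ≥0∞} {x ω : En n} (hω : ‖ω‖ = 1) {t : ℝ}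
    (h : ∀ r : ℝ, 0 < r → ‖kDiff k f (r • ω) (x + t • ω)‖ₑ ≤
      ENNReal.ofReal (c * r ^ (k - 1)) * ∫⁻ v in Icc t (t + k * r), F (x + v • ω)) :
    dirSize k μ γ f (x + t • ω) ω ≤ raySize k γ (μ / c) (fun v => F (x + v • ω)) t := by
  refine setLIntegral_mono' measurableSet_Ioi fun r hr => ?_
  have hr : 0 < r := hr
  have hnorm : ‖r • ω‖ = r := by rw [norm_smul, hω, mul_one, Real.norm_of_nonneg hr.le]
  by_cases hE : memE k k μ γ f (x + t • ω) (r • ω)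
  · have hlt : ENNReal.ofReal (μ / c * r ^ (1 + γ)) <
        ∫⁻ v in Icc t (t + k * r), F (x + v • ω) := by
      have h1 := hE.2
      rw [hnorm] at h1
      have h2 : ENNReal.ofReal (μ * r ^ ((k : ℝ) + γ)) < ‖kDiff k f (r • ω) (x + t • ω)‖ₑ := by
        rw [Real.enorm_eq_ofReal_abs]
        exact (ENNReal.ofReal_lt_ofReal_iff_of_nonneg (by positivity)).2 h1
      have h3 := h2.trans_le (h r hr)
      have h4 : μ * r ^ ((k : ℝ) + γ) = c * r ^ (k - 1) * (μ / c * r ^ (1 + γ)) := by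
        rw [show (k : ℝ) + γ = ((k - 1 : ℕ) : ℝ) + (1 + γ) by
          rw [Nat.cast_sub hk]; push_cast; ring, Real.rpow_add hr, Real.rpow_natCast]
        field_simp
      rw [h4, ENNReal.ofReal_mul (by positivity)] at h3
      exact lt_of_mul_lt_mul_left' h3
    rw [if_pos hE, if_pos hlt, hnorm, ← ENNReal.ofReal_mul (by positivity)]
    refine ENNReal.ofReal_le_ofReal (le_of_eq ?_)
    rw [← Real.rpow_natCast, ← Real.rpow_add hr, Nat.cast_sub hn]
    congr 1
    push_cast
    ring
  · simp [hE]

/-- The `q = 1` estimate, conditional on a bound of differences by averages along segments. -/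
theorem exists_lintegral_innerInt_rpow_le {n k : ℕ} (hn : 0 < n) (hk : 0 < k) {p γ c : ℝ}
    (hp : 1 ≤ p) (hγ : γ ∈ Gam p 1) (hc : 0 < c) :
    ∃ C : ℝ, 0 < C ∧ ∀ (f : En n → ℝ) (F : En n → ℝ≥0∞), Continuous f → Measurable F →
      (∀ (x ω : En n) (t r : ℝ), ‖ω‖ = 1 → 0 < r → ‖kDiff k f (r • ω) (x + t • ω)‖ₑ ≤
        ENNReal.ofReal (c * r ^ (k - 1)) * ∫⁻ v in Icc t (t + k * r), F (x + v • ω)) →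
      ∀ μ : ℝ, 0 < μ → ∫⁻ x, innerInt k k μ γ γ f x ^ p ≤
        ENNReal.ofReal (C / μ ^ p) * ∫⁻ x, F x ^ p := by
  have hp0 : 0 < p := by linarith
  obtain ⟨K, hK, hray⟩ := exists_lintegral_raySize_rpow_le
    (κ := k) (by exact_mod_cast hk) hp hγ
  set σ : Measure (Metric.sphere (0 : En n) 1) := (volume : Measure (En n)).toSphere with hσ
  set S : ℝ := σ.real univ ^ p + 1 with hS
  have hS0 : 0 < S := by positivity
  have hσS : σ univ ^ (p - 1) * σ univ ≤ ENNReal.ofReal S := by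
    have h1 : σ univ ^ (p - 1) * σ univ = σ univ ^ p := by
      conv_lhs => rw [← ENNReal.rpow_one (σ univ), ← ENNReal.rpow_mul, one_mul]
      rw [← ENNReal.rpow_add_of_nonneg _ _ (by linarith) zero_le_one, sub_add_cancel]
    rw [h1, ← ENNReal.ofReal_toReal (measure_ne_top σ univ),
      ENNReal.ofReal_rpow_of_nonneg ENNReal.toReal_nonneg hp0.le]
    exact ENNReal.ofReal_le_ofReal (by simp [hS, Measure.real])
  refine ⟨S * (K * c ^ p), by positivity, fun f F hf hF hdiff μ hμ => ?_⟩
  have hdm := measurable_dirSize k μ γ hf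
  have hdm' : Measurable fun z : En n × Metric.sphere (0 : En n) 1 =>
      dirSize k μ γ f z.1 (z.2 : En n) :=
    hdm.comp (f := fun z : En n × Metric.sphere (0 : En n) 1 => (z.1, (z.2 : En n)))
      (by fun_prop)
  have hpolar : ∀ x, innerInt k k μ γ γ f x = ∫⁻ ω, dirSize k μ γ f x (ω : En n) ∂σ := fun x =>
    lintegral_polar hn ((measurable_memE_weight k k μ γ γ hf).comp measurable_prodMk_left)
  calc ∫⁻ x, innerInt k k μ γ γ f x ^ p
      ≤ ∫⁻ x, σ univ ^ (p - 1) * ∫⁻ ω, dirSize k μ γ f x (ω : En n) ^ p ∂σ := by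
        refine lintegral_mono fun x => ?_
        rw [hpolar]
        simpa using rpow_lintegral_mul_le (ν := σ) hp (w := fun _ => 1) aemeasurable_const
          (hdm'.comp measurable_prodMk_left).aemeasurable
    _ = σ univ ^ (p - 1) * ∫⁻ ω, (∫⁻ x, dirSize k μ γ f x (ω : En n) ^ p) ∂σ := by
        rw [lintegral_const_mul' _ _ (by finiteness),
          lintegral_lintegral_swap (hdm'.pow_const p).aemeasurable]
    _ ≤ σ univ ^ (p - 1) * ∫⁻ ω, (ENNReal.ofReal (K / (μ / c) ^ p) * ∫⁻ x, F x ^ p) ∂σ := by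
        refine mul_le_mul' le_rfl (lintegral_mono fun ω => ?_)
        have hω : ‖(ω : En n)‖ = 1 := by simp
        refine lintegral_le_of_forall_lines hω
          ((hdm.comp measurable_prodMk_right).pow_const p) (hF.pow_const p)
          ENNReal.ofReal_ne_top fun x => ?_
        refine le_trans (lintegral_mono fun t => ?_)
          (hray (μ / c) (fun v => F (x + v • (ω : En n))) (by positivity)
            (hF.comp (by fun_prop)))
        exact ENNReal.rpow_le_rpow (dirSize_le_raySize hn hk hμ hc hω fun r hr =>
          hdiff x ω t r hω hr) hp0.le
    _ = σ univ ^ (p - 1) * σ univ * (ENNReal.ofReal (K / (μ / c) ^ p) * ∫⁻ x, F x ^ p) := by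
        rw [lintegral_const]
        ring
    _ ≤ ENNReal.ofReal S * (ENNReal.ofReal (K / (μ / c) ^ p) * ∫⁻ x, F x ^ p) := by gcongr
    _ = _ := by
        rw [← mul_assoc, ← ENNReal.ofReal_mul hS0.le, Real.div_rpow hμ.le hc.le]
        congr 2
        field_simp

theorem kDiff_eq_fwdDiff_iterate {n : ℕ} (k : ℕ) (f : En n → ℝ) (h x : En n) :
    kDiff k f h x = (fwdDiff h)^[k] f x := by
  rw [fwdDiff_iter_eq_sum_shift, kDiff]
  refine Finset.sum_congr rfl fun j _ => ?_
  rw [zsmul_eq_mul, Nat.cast_smul_eq_nsmul ℝ j h]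
  push_cast
  ring

theorem kDiff_zero {n : ℕ} (f : En n → ℝ) (h x : En n) : kDiff 0 f h x = f x := by
  simp [kDiff]

theorem kDiff_succ {n : ℕ} (k : ℕ) (f : En n → ℝ) (h x : En n) :
    kDiff (k + 1) f h x = kDiff k f h (x + h) - kDiff k f h x := by
  simp only [kDiff_eq_fwdDiff_iterate, Function.iterate_succ_apply', fwdDiff]

/-- The derivative of `f` in the direction `v`. -/
noncomputable def dirDeriv {n : ℕ} (v : En n) (f : En n → ℝ) : En n → ℝ := fun x => fderiv ℝ f x v

theorem contDiff_dirDeriv {n : ℕ} (v : En n) {f : En n → ℝ} (hf : ContDiff ℝ (⊤ : ℕ∞) f) :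
    ContDiff ℝ (⊤ : ℕ∞) (dirDeriv v f) :=
  (hf.fderiv_right (m := (⊤ : ℕ∞)) le_rfl).clm_apply contDiff_const

theorem hasDerivAt_kDiff_line {n : ℕ} (k : ℕ) {f : En n → ℝ} (hf : Differentiable ℝ f)
    (h x ω : En n) (t : ℝ) :
    HasDerivAt (fun u : ℝ => kDiff k f h (x + u • ω)) (kDiff k (dirDeriv ω f) h (x + t • ω)) t := by
  unfold kDiff
  refine HasDerivAt.fun_sum fun j _ => HasDerivAt.const_mul _ ?_
  have h1 : HasDerivAt (fun u : ℝ => x + u • ω + (j : ℝ) • h) ω t := by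
    simpa using (((hasDerivAt_id t).smul_const ω).const_add x).add_const ((j : ℝ) • h)
  exact (hf _).hasFDerivAt.comp_hasDerivAt t h1

theorem enorm_kDiff_succ_le_lintegral {n : ℕ} (k : ℕ) {f : En n → ℝ}
    (hf : ContDiff ℝ (⊤ : ℕ∞) f) (h x ω : En n) {t r : ℝ} (hr : 0 < r) (hh : h = r • ω) :
    ‖kDiff (k + 1) f h (x + t • ω)‖ₑ ≤
      ∫⁻ u in Icc t (t + r), ‖kDiff k (dirDeriv ω f) h (x + u • ω)‖ₑ := by
  have hcont : Continuous fun u : ℝ => kDiff k (dirDeriv ω f) h (x + u • ω) :=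
    (continuous_kDiff k (contDiff_dirDeriv ω hf).continuous).comp
      (f := fun u : ℝ => (x + u • ω, h)) (by fun_prop)
  have hftc := intervalIntegral.integral_eq_sub_of_hasDerivAt (a := t) (b := t + r)
    (fun u _ => hasDerivAt_kDiff_line k (hf.differentiable (by simp)) h x ω u)
    (hcont.intervalIntegrable _ _)
  have : kDiff (k + 1) f h (x + t • ω) =
      ∫ u in t..(t + r), kDiff k (dirDeriv ω f) h (x + u • ω) := by
    rw [hftc, kDiff_succ, hh, add_smul, ← add_assoc]
  rw [this, intervalIntegral.integral_of_le (by linarith)]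
  exact (enorm_integral_le_lintegral_enorm _).trans (lintegral_mono_set Ioc_subset_Icc_self)

theorem enorm_kDiff_le_lintegral_dirDeriv {n : ℕ} (k : ℕ) {f : En n → ℝ}
    (hf : ContDiff ℝ (⊤ : ℕ∞) f) (x ω : En n) (t : ℝ) {r : ℝ} (hr : 0 < r) :
    ‖kDiff (k + 1) f (r • ω) (x + t • ω)‖ₑ ≤ ENNReal.ofReal (r ^ k) *
      ∫⁻ v in Icc t (t + (k + 1 : ℕ) * r), ‖((dirDeriv ω)^[k + 1] f) (x + v • ω)‖ₑ := by
  induction k generalizing f t with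
  | zero => simpa [kDiff_zero] using enorm_kDiff_succ_le_lintegral 0 hf _ x ω (t := t) hr rfl
  | succ k ih =>
    refine (enorm_kDiff_succ_le_lintegral (k + 1) hf _ x ω hr rfl).trans ?_
    calc ∫⁻ u in Icc t (t + r), ‖kDiff (k + 1) (dirDeriv ω f) (r • ω) (x + u • ω)‖ₑ
        ≤ ∫⁻ u in Icc t (t + r), ENNReal.ofReal (r ^ k) *
            ∫⁻ v in Icc t (t + (k + 1 + 1 : ℕ) * r),
              ‖((dirDeriv ω)^[k + 1 + 1] f) (x + v • ω)‖ₑ := by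
          refine setLIntegral_mono' measurableSet_Icc fun u hu => ?_
          refine (ih (contDiff_dirDeriv ω hf) u).trans ?_
          refine mul_le_mul' le_rfl (lintegral_mono_set (Icc_subset_Icc hu.1 ?_))
          push_cast
          linarith [hu.2]
      _ = _ := by
          rw [setLIntegral_const, Real.volume_Icc, add_sub_cancel_left, mul_right_comm,
            ← ENNReal.ofReal_mul (by positivity), ← pow_succ]

/-- Iterated partial derivatives along a list of coordinate directions. -/
noncomputable def pdList {n : ℕ} (L : List (Fin n)) (f : En n → ℝ) : En n → ℝ := L.foldr pd f

theorem contDiff_pd {n : ℕ} (i : Fin n) {f : En n → ℝ} (hf : ContDiff ℝ (⊤ : ℕ∞) f) :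
    ContDiff ℝ (⊤ : ℕ∞) (pd i f) := contDiff_dirDeriv _ hf

theorem contDiff_pdList {n : ℕ} (L : List (Fin n)) {f : En n → ℝ} (hf : ContDiff ℝ (⊤ : ℕ∞) f) :
    ContDiff ℝ (⊤ : ℕ∞) (pdList L f) := by
  induction L with
  | nil => exact hf
  | cons i L ih => exact contDiff_pd i ih

theorem pd_comm {n : ℕ} (i j : Fin n) {f : En n → ℝ} (hf : ContDiff ℝ (⊤ : ℕ∞) f) :
    pd i (pd j f) = pd j (pd i f) := by
  ext x
  have hd : DifferentiableAt ℝ (fderiv ℝ f) x :=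
    (hf.fderiv_right (m := (⊤ : ℕ∞)) le_rfl).differentiable (by simp) x
  have key : ∀ a b : En n, fderiv ℝ (fun y => fderiv ℝ f y a) x b = fderiv ℝ (fderiv ℝ f) x b a := by
    intro a b
    rw [(hd.hasFDerivAt.clm_apply (hasFDerivAt_const a x)).fderiv]
    simp
  have hsymm : IsSymmSndFDerivAt ℝ f x :=
    hf.contDiffAt.isSymmSndFDerivAt (by
      rw [minSmoothness_of_isRCLikeNormedField]
      exact WithTop.coe_le_coe.2 (le_top (a := (2 : ℕ∞))))
  unfold pd
  rw [key, key]
  exact hsymm _ _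

theorem pdList_perm {n : ℕ} {L L' : List (Fin n)} (h : L.Perm L') {f : En n → ℝ}
    (hf : ContDiff ℝ (⊤ : ℕ∞) f) : pdList L f = pdList L' f := by
  induction h with
  | nil => rfl
  | cons i _ ih => exact congrArg (pd i) ih
  | swap i j L => exact pd_comm j i (contDiff_pdList L hf)
  | trans _ _ ih₁ ih₂ => exact ih₁.trans ih₂

theorem pdList_append {n : ℕ} (L L' : List (Fin n)) (f : En n → ℝ) :
    pdList (L ++ L') f = pdList L (pdList L' f) := by
  simp [pdList]

theorem pdList_replicate {n : ℕ} (m : ℕ) (i : Fin n) (f : En n → ℝ) :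
    pdList (List.replicate m i) f = (pd i)^[m] f := by
  induction m with
  | zero => rfl
  | succ m ih =>
    rw [Function.iterate_succ_apply', ← ih, List.replicate_succ]
    rfl

theorem mpd_eq_pdList {n : ℕ} (α : Fin n → ℕ) (f : En n → ℝ) :
    mpd α f = pdList ((List.finRange n).flatMap fun i => List.replicate (α i) i) f := by
  unfold mpd
  induction List.finRange n with
  | nil => rfl
  | cons i L ih => rw [List.foldr_cons, List.flatMap_cons, pdList_append, pdList_replicate, ih]

theorem pdList_eq_mpd {n : ℕ} (L : List (Fin n)) {f : En n → ℝ} (hf : ContDiff ℝ (⊤ : ℕ∞) f) :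
    pdList L f = mpd (fun i => L.count i) f := by
  rw [mpd_eq_pdList]
  refine pdList_perm (List.perm_iff_count.2 fun a => ?_) hf
  rw [List.count_flatMap]
  have : (List.count a ∘ fun i => List.replicate (L.count i) i) =
      fun i => if i = a then L.count a else 0 := by
    ext i
    by_cases h : i = a
    · simp [h]
    · simp [List.count_replicate, h]
  rw [this, ← List.ofFn_eq_map, List.sum_ofFn]
  simp

theorem sum_count_eq_length {n : ℕ} (L : List (Fin n)) : ∑ i, L.count i = L.length := by
  simpa using (Multiset.sum_count_eq_card (s := Finset.univ) (m := (L : Multiset (Fin n))) (by simp))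

theorem pdList_sum {n : ℕ} (L : List (Fin n)) (c : Fin n → ℝ) {g : Fin n → En n → ℝ}
    (hg : ∀ i, ContDiff ℝ (⊤ : ℕ∞) (g i)) :
    pdList L (fun x => ∑ i, c i * g i x) = fun x => ∑ i, c i * pdList L (g i) x := by
  induction L with
  | nil => rfl
  | cons j L ih =>
    have hd : ∀ i, Differentiable ℝ (pdList L (g i)) := fun i =>
      (contDiff_pdList L (hg i)).differentiable (by simp)
    change pd j (pdList L _) = fun x => ∑ i, c i * pd j (pdList L (g i)) x
    rw [ih]
    ext x
    unfold pd
    rw [(HasFDerivAt.fun_sum (u := Finset.univ)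
      fun i _ => ((hd i x).hasFDerivAt.const_mul (c i))).fderiv]
    simp

theorem dirDeriv_eq_sum_pd {n : ℕ} (v : En n) (f : En n → ℝ) :
    dirDeriv v f = fun x => ∑ i, v i * pd i f x := by
  ext x
  have hv : v = ∑ i, v i • EuclideanSpace.single i (1 : ℝ) := by
    simpa using ((EuclideanSpace.basisFun (Fin n) ℝ).sum_repr v).symm
  unfold dirDeriv pd
  conv_lhs => rw [hv]
  simp [map_sum]

theorem abs_dirDeriv_iterate_le {n : ℕ} (m : ℕ) {f : En n → ℝ} (hf : ContDiff ℝ (⊤ : ℕ∞) f)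
    {v : En n} (hv : ‖v‖ ≤ 1) (x : En n) {G : ℝ}
    (hG : ∀ L : List (Fin n), L.length = m → |pdList L f x| ≤ G) :
    |(dirDeriv v)^[m] f x| ≤ (n : ℝ) ^ m * G := by
  induction m generalizing f G with
  | zero => simpa [pdList] using hG [] rfl
  | succ m ih =>
    rw [Function.iterate_succ_apply]
    refine (ih (contDiff_dirDeriv v hf) (G := n * G) fun L hL => ?_).trans
      (le_of_eq (by rw [pow_succ, mul_assoc]))
    rw [dirDeriv_eq_sum_pd, pdList_sum L _ fun i => contDiff_pd i hf]
    refine (Finset.abs_sum_le_sum_abs _ _).trans ?_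
    calc ∑ i, |v i * pdList L (pd i f) x| ≤ ∑ _i : Fin n, G := by
          refine Finset.sum_le_sum fun i _ => ?_
          have h1 : |v i| ≤ 1 := (PiLp.norm_apply_le v i).trans hv
          have h2 : |pdList L (pd i f) x| ≤ G := by
            have := hG (L ++ [i]) (by simp [hL])
            rwa [pdList_append] at this
          rw [abs_mul]
          calc |v i| * |pdList L (pd i f) x| ≤ 1 * |pdList L (pd i f) x| := by gcongr
            _ ≤ G := by rwa [one_mul]
      _ = n * G := by simp

theorem abs_dirDeriv_iterate_le_of_mpd {n : ℕ} (m : ℕ) {f : En n → ℝ}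
    (hf : ContDiff ℝ (⊤ : ℕ∞) f) {v : En n} (hv : ‖v‖ ≤ 1) (x : En n) {G : ℝ}
    (hG : ∀ α : Fin n → ℕ, ∑ i, α i = m → |mpd α f x| ≤ G) :
    |(dirDeriv v)^[m] f x| ≤ (n : ℝ) ^ m * G :=
  abs_dirDeriv_iterate_le m hf hv x fun L hL => by
    rw [pdList_eq_mpd L hf]
    exact hG _ ((sum_count_eq_length L).trans hL)

theorem enorm_dirDeriv_iterate_le_of_mpd {n : ℕ} (m : ℕ) {f : En n → ℝ}
    (hf : ContDiff ℝ (⊤ : ℕ∞) f) {v : En n} (hv : ‖v‖ ≤ 1) (x : En n) {G : ℝ≥0∞}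
    (hG : ∀ α : Fin n → ℕ, ∑ i, α i = m → ‖mpd α f x‖ₑ ≤ G) (hn : 0 < n) :
    ‖(dirDeriv v)^[m] f x‖ₑ ≤ ENNReal.ofReal ((n : ℝ) ^ m) * G := by
  have hpos : 0 < (n : ℝ) ^ m := by positivity
  rcases eq_or_ne G ⊤ with rfl | hGt
  · rw [ENNReal.mul_top (ENNReal.ofReal_pos.2 hpos).ne']
    exact le_top
  lift G to ℝ≥0 using hGt
  have := abs_dirDeriv_iterate_le_of_mpd m hf hv x (G := G) fun α hα => by
    have := hG α hα
    rwa [Real.enorm_eq_ofReal_abs, ENNReal.ofReal_le_iff_le_toReal ENNReal.coe_ne_top,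
      ENNReal.coe_toReal] at this
  rw [Real.enorm_eq_ofReal_abs, ← ENNReal.ofReal_coe_nnreal, ← ENNReal.ofReal_mul hpos.le]
  exact ENNReal.ofReal_le_ofReal this

theorem enorm_kDiff_le_lintegral_of_mpd {n k : ℕ} (hn : 0 < n) (hk : 0 < k) {f : En n → ℝ}
    (hf : ContDiff ℝ (⊤ : ℕ∞) f) {F : En n → ℝ≥0∞}
    (hF : ∀ x, ∀ α : Fin n → ℕ, ∑ i, α i = k → ‖mpd α f x‖ₑ ≤ F x) (x : En n) {ω : En n}
    (hω : ‖ω‖ = 1) (t : ℝ) {r : ℝ} (hr : 0 < r) :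
    ‖kDiff k f (r • ω) (x + t • ω)‖ₑ ≤ ENNReal.ofReal ((n : ℝ) ^ k * r ^ (k - 1)) *
      ∫⁻ v in Icc t (t + k * r), F (x + v • ω) := by
  obtain ⟨m, rfl⟩ : ∃ m, k = m + 1 := ⟨k - 1, by omega⟩
  refine (enorm_kDiff_le_lintegral_dirDeriv m hf x ω t hr).trans ?_
  rw [mul_comm ((n : ℝ) ^ (m + 1)), ENNReal.ofReal_mul (by positivity), mul_assoc,
    Nat.add_sub_cancel]
  refine mul_le_mul' le_rfl ?_
  rw [← lintegral_const_mul' (ENNReal.ofReal ((n : ℝ) ^ (m + 1))) _ ENNReal.ofReal_ne_top]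
  exact lintegral_mono fun v =>
    enorm_dirDeriv_iterate_le_of_mpd (m + 1) hf hω.le _ (hF _) hn

theorem abs_kDiff_le_of_dirDeriv {n m : ℕ} {f : En n → ℝ} (hf : ContDiff ℝ (⊤ : ℕ∞) f)
    {ω : En n} {B : ℝ} (hB : ∀ x, |(dirDeriv ω)^[m] f x| ≤ B) (x : En n) {r : ℝ} (hr : 0 < r) :
    |kDiff m f (r • ω) x| ≤ (m + 1) * B * r ^ m := by
  have hB0 : 0 ≤ B := (abs_nonneg _).trans (hB 0)
  rcases m with _ | m
  · simpa [kDiff_zero] using hB x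
  have h := enorm_kDiff_le_lintegral_dirDeriv m hf x ω 0 hr
  rw [zero_smul, add_zero] at h
  have h2 : ∫⁻ v in Icc 0 (0 + (m + 1 : ℕ) * r), ‖((dirDeriv ω)^[m + 1] f) (x + v • ω)‖ₑ ≤
      ENNReal.ofReal (B * ((m + 1 : ℕ) * r)) := by
    calc _ ≤ ∫⁻ v in Icc 0 (0 + (m + 1 : ℕ) * r), ENNReal.ofReal B :=
          lintegral_mono fun v => by
            rw [Real.enorm_eq_ofReal_abs]
            exact ENNReal.ofReal_le_ofReal (hB _)
      _ = _ := by
          rw [setLIntegral_const, Real.volume_Icc, ← ENNReal.ofReal_mul hB0]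
          simp
  have h3 := h.trans (mul_le_mul' le_rfl h2)
  rw [← ENNReal.ofReal_mul (by positivity), Real.enorm_eq_ofReal_abs,
    ENNReal.ofReal_le_ofReal_iff (by positivity)] at h3
  refine h3.trans ?_
  rw [pow_succ]
  push_cast
  nlinarith [mul_nonneg (mul_nonneg (pow_nonneg hr.le m) hB0) hr.le]

theorem abs_kDiff_le_of_mpd {n k : ℕ} (hk : 0 < k) {f : En n → ℝ}
    (hf : ContDiff ℝ (⊤ : ℕ∞) f) {A : ℝ}
    (hA : ∀ x, ∀ α : Fin n → ℕ, ∑ i, α i = k - 1 → |mpd α f x| ≤ A) (x : En n) {h : En n}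
    (hh : h ≠ 0) : |kDiff k f h x| ≤ 2 * k * n ^ (k - 1) * A * ‖h‖ ^ (k - 1) := by
  obtain ⟨m, rfl⟩ : ∃ m, k = m + 1 := ⟨k - 1, by omega⟩
  rw [Nat.add_sub_cancel] at hA ⊢
  have hr : 0 < ‖h‖ := norm_pos_iff.2 hh
  set ω : En n := ‖h‖⁻¹ • h with hω
  have hω1 : ‖ω‖ ≤ 1 := by rw [hω, norm_smul, norm_inv, norm_norm, inv_mul_cancel₀ hr.ne']
  have hhω : h = ‖h‖ • ω := by rw [hω, smul_smul, mul_inv_cancel₀ hr.ne', one_smul]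
  have key : ∀ y, |kDiff m f h y| ≤ (m + 1) * (n ^ m * A) * ‖h‖ ^ m := by
    intro y
    conv_lhs => rw [hhω]
    exact abs_kDiff_le_of_dirDeriv hf
      (fun z => abs_dirDeriv_iterate_le_of_mpd m hf hω1 z (hA z)) y hr
  rw [kDiff_succ]
  refine (abs_sub _ _).trans ((add_le_add (key _) (key _)).trans (le_of_eq ?_))
  push_cast
  ring

theorem memE_of_abs_kDiff_le {n k : ℕ} (hk : 0 < k) {γ s lam B : ℝ} (hs : s ∈ Ioo (0 : ℝ) 1)
    (hlam : 0 < lam) (hB : 0 < B) {f : En n → ℝ} {x h : En n}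
    (hle : |kDiff k f h x| ≤ B * ‖h‖ ^ (k - 1)) (hE : memE k k lam (γ / (1 / s) + s - 1) f x h) :
    memE k k (lam ^ (1 / s) * B ^ (1 - 1 / s)) γ f x h := by
  obtain ⟨h0, hlt⟩ := hE
  refine ⟨h0, lt_of_le_of_lt ?_ hlt⟩
  have hs0 : 0 < s := hs.1
  have hr : 0 < ‖h‖ := norm_pos_iff.2 h0
  set r := ‖h‖
  have hkc : (k : ℝ) = ((k - 1 : ℕ) : ℝ) + 1 := by rw [Nat.cast_sub hk]; push_cast; ring
  set u : ℝ := r ^ ((γ + 1) * s) with hu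
  have hu0 : 0 < u := by positivity
  have e1 : r ^ ((k : ℝ) + (γ / (1 / s) + s - 1)) = r ^ (k - 1) * u := by
    rw [hu, ← Real.rpow_natCast, ← Real.rpow_add hr, hkc]
    congr 1
    field_simp
    ring
  have e2 : r ^ ((k : ℝ) + γ) = r ^ (k - 1) * u ^ (1 / s) := by
    rw [hu, ← Real.rpow_mul hr.le, ← Real.rpow_natCast, ← Real.rpow_add hr, hkc]
    congr 1
    field_simp
    ring
  have hluB : lam * u ≤ B := by
    have := hlt.le.trans hle
    rw [e1] at this
    have hrk : 0 < r ^ (k - 1) := by positivity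
    refine le_of_mul_le_mul_left ?_ hrk
    linarith
  have hq : 0 ≤ 1 / s - 1 := by
    have := one_le_one_div hs0 hs.2.le
    linarith
  have hpow : (lam * u) ^ (1 / s) * B ^ (1 - 1 / s) ≤ lam * u := by
    have h1 : (lam * u) ^ (1 / s - 1) ≤ B ^ (1 / s - 1) :=
      Real.rpow_le_rpow (by positivity) hluB hq
    calc (lam * u) ^ (1 / s) * B ^ (1 - 1 / s)
        = lam * u * ((lam * u) ^ (1 / s - 1) * B ^ (1 - 1 / s)) := by
          rw [← mul_assoc, ← Real.rpow_one_add' (by positivity) (by simpa using hs0.ne'),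
            add_sub_cancel]
      _ ≤ lam * u * (B ^ (1 / s - 1) * B ^ (1 - 1 / s)) := by gcongr
      _ = lam * u := by
          rw [← Real.rpow_add hB]
          simp
  rw [e1, e2]
  rw [Real.mul_rpow hlam.le hu0.le] at hpow
  have hrk : 0 ≤ r ^ (k - 1) := by positivity
  nlinarith [mul_le_mul_of_nonneg_left hpow hrk]

theorem innerInt_mono {n k ℓ k' ℓ' : ℕ} {lam lam' b b' γ : ℝ} {f : En n → ℝ} {x : En n}
    (h : ∀ y, memE k ℓ lam b f x y → memE k' ℓ' lam' b' f x y) :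
    innerInt k ℓ lam b γ f x ≤ innerInt k' ℓ' lam' b' γ f x := by
  refine lintegral_mono fun y => ?_
  by_cases h1 : memE k ℓ lam b f x y
  · simp [h1, h y h1]
  · simp [h1]

/-- The Gagliardo-Nirenberg type estimate for smooth functions. -/
theorem exists_gagliardoNirenberg_smooth {n k : ℕ} (hn : 0 < n) (hk : 0 < k) {p γ s : ℝ}
    (hp : 1 ≤ p) (hγ : γ ∈ Gam p 1) (hs : s ∈ Ioo (0 : ℝ) 1) :
    ∃ C : ℝ, 0 < C ∧ ∀ (f : En n → ℝ) (F : En n → ℝ≥0∞) (A : ℝ), ContDiff ℝ (⊤ : ℕ∞) f →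
      Measurable F → 0 ≤ A →
      (∀ x, ∀ α : Fin n → ℕ, ∑ i, α i = k → ‖mpd α f x‖ₑ ≤ F x) →
      (∀ x, ∀ α : Fin n → ℕ, ∑ i, α i = k - 1 → |mpd α f x| ≤ A) →
      ∀ lam : ℝ, 0 < lam → ENNReal.ofReal lam *
          (∫⁻ x, innerInt k k lam (γ / (1 / s) + s - 1) γ f x ^ p) ^ (1 / (p * (1 / s))) ≤
        ENNReal.ofReal C * ENNReal.ofReal A ^ (1 - s) * ((∫⁻ x, F x ^ p) ^ (1 / p)) ^ s := by
  have hp0 : 0 < p := by linarith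
  have hs0 : 0 < s := hs.1
  have hs1 : 0 < 1 - s := by linarith [hs.2]
  have hexp : 1 / (p * (1 / s)) = s / p := by field_simp
  obtain ⟨K, hK, hest⟩ := exists_lintegral_innerInt_rpow_le (n := n) (k := k) hn hk hp hγ
    (c := (n : ℝ) ^ k) (by positivity)
  set c : ℝ := 2 * k * n ^ (k - 1) with hc
  have hc0 : 0 < c := by positivity
  refine ⟨K ^ (s / p) * c ^ (1 - s), by positivity, fun f F A hf hF hA hFk hAk lam hlam => ?_⟩
  have hsup : ∀ x h, h ≠ 0 → |kDiff k f h x| ≤ c * A * ‖h‖ ^ (k - 1) := fun x h hh =>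
    abs_kDiff_le_of_mpd hk hf hAk x hh
  rw [hexp]
  rcases hA.eq_or_lt with rfl | hA
  · have hzero : ∀ x, innerInt k k lam (γ / (1 / s) + s - 1) γ f x = 0 := by
      intro x
      have hno : ∀ h, ¬ memE k k lam (γ / (1 / s) + s - 1) f x h := by
        rintro h ⟨h0, hlt⟩
        have h1 := hsup x h h0
        rw [mul_zero, zero_mul] at h1
        have : 0 < lam * ‖h‖ ^ ((k : ℝ) + (γ / (1 / s) + s - 1)) := by positivity
        linarith
      unfold innerInt
      simp only [hno, if_false, lintegral_zero]
    simp only [hzero]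
    simp [ENNReal.zero_rpow_of_pos hp0, ENNReal.zero_rpow_of_pos (div_pos hs0 hp0)]
  have hB : 0 < c * A := by positivity
  set μ : ℝ := lam ^ (1 / s) * (c * A) ^ (1 - 1 / s) with hμ
  have hμ0 : 0 < μ := by positivity
  have hreal : lam * (K / μ ^ p) ^ (s / p) = K ^ (s / p) * c ^ (1 - s) * A ^ (1 - s) := by
    have h1 : (μ ^ p) ^ (s / p) = lam * ((c * A) ^ (1 - s))⁻¹ := by
      rw [← Real.rpow_mul hμ0.le, mul_div_cancel₀ _ hp0.ne', hμ,
        Real.mul_rpow (by positivity) (by positivity), ← Real.rpow_mul hlam.le,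
        ← Real.rpow_mul hB.le, one_div_mul_cancel hs0.ne', Real.rpow_one, ← Real.rpow_neg hB.le]
      congr 2
      field_simp
      ring
    rw [Real.div_rpow hK.le (by positivity), h1, Real.mul_rpow hc0.le hA.le]
    field_simp
  calc ENNReal.ofReal lam *
          (∫⁻ x, innerInt k k lam (γ / (1 / s) + s - 1) γ f x ^ p) ^ (s / p)
      ≤ ENNReal.ofReal lam * (ENNReal.ofReal (K / μ ^ p) * ∫⁻ x, F x ^ p) ^ (s / p) := by
        gcongr
        refine le_trans (lintegral_mono fun x => ?_) (hest f F hf.continuous hF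
          (fun x ω t r hω hr => enorm_kDiff_le_lintegral_of_mpd hn hk hf hFk x hω t hr) μ hμ0)
        exact ENNReal.rpow_le_rpow (innerInt_mono fun h hE =>
          memE_of_abs_kDiff_le hk hs hlam hB (hsup x h hE.1) hE) hp0.le
    _ = _ := by
        rw [ENNReal.mul_rpow_of_nonneg _ _ (by positivity),
          ENNReal.ofReal_rpow_of_pos (by positivity), ← mul_assoc,
          ← ENNReal.ofReal_mul hlam.le, hreal, ENNReal.ofReal_mul (by positivity),
          ENNReal.ofReal_rpow_of_pos hA, ← ENNReal.rpow_mul (∫⁻ x, F x ^ p), one_div_mul_eq_div]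

theorem pd_comp_const_sub {n : ℕ} (i : Fin n) {φ : En n → ℝ} (hφ : Differentiable ℝ φ) (c : ℝ)
    (x : En n) : pd i (fun y => c * φ (x - y)) = fun y => -c * pd i φ (x - y) := by
  ext y
  have h1 : HasFDerivAt (fun y => x - y) (-ContinuousLinearMap.id ℝ (En n)) y :=
    (hasFDerivAt_id y).const_sub x
  have h2 := ((hφ (x - y)).hasFDerivAt.comp y h1).const_mul c
  unfold pd
  rw [show (fun y => c * φ (x - y)) = fun y => c * (φ ∘ fun y => x - y) y from rfl, h2.fderiv]
  simp

theorem pdList_comp_const_sub {n : ℕ} (L : List (Fin n)) {φ : En n → ℝ}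
    (hφ : ContDiff ℝ (⊤ : ℕ∞) φ) (x : En n) :
    pdList L (fun y => φ (x - y)) = fun y => (-1) ^ L.length * pdList L φ (x - y) := by
  induction L with
  | nil => simp [pdList]
  | cons i L ih =>
    change pd i (pdList L _) = fun y => (-1) ^ (L.length + 1) * pd i (pdList L φ) (x - y)
    rw [ih, pd_comp_const_sub i ((contDiff_pdList L hφ).differentiable (by simp))]
    ext y
    ring

theorem mpd_comp_const_sub {n : ℕ} (α : Fin n → ℕ) {φ : En n → ℝ}
    (hφ : ContDiff ℝ (⊤ : ℕ∞) φ) (x : En n) :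
    mpd α (fun y => φ (x - y)) = fun y => (-1) ^ (∑ i, α i) * mpd α φ (x - y) := by
  simp only [mpd_eq_pdList]
  rw [pdList_comp_const_sub _ hφ, List.length_flatMap]
  simp [← List.ofFn_eq_map, List.sum_ofFn]

theorem hasCompactSupport_pd {n : ℕ} (i : Fin n) {φ : En n → ℝ} (hφ : HasCompactSupport φ) :
    HasCompactSupport (pd i φ) :=
  hφ.fderiv_apply ℝ (EuclideanSpace.single i (1 : ℝ))

theorem hasCompactSupport_pdList {n : ℕ} (L : List (Fin n)) {φ : En n → ℝ}
    (hφ : HasCompactSupport φ) : HasCompactSupport (pdList L φ) := by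
  induction L with
  | nil => exact hφ
  | cons i L ih => exact hasCompactSupport_pd i ih

/-- The convolution of real functions on `ℝⁿ`. -/
noncomputable def realConv {n : ℕ} (f φ : En n → ℝ) (x : En n) : ℝ := ∫ t, f t * φ (x - t)

theorem realConv_eq {n : ℕ} (f φ : En n → ℝ) :
    realConv f φ = convolution f φ (ContinuousLinearMap.mul ℝ ℝ) volume := rfl

theorem contDiff_realConv {n : ℕ} {f φ : En n → ℝ} (hf : LocallyIntegrable f volume)
    (hφ : ContDiff ℝ (⊤ : ℕ∞) φ) (hc : HasCompactSupport φ) :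
    ContDiff ℝ (⊤ : ℕ∞) (realConv f φ) :=
  hc.contDiff_convolution_right (ContinuousLinearMap.mul ℝ ℝ) hf hφ

theorem pd_realConv {n : ℕ} (i : Fin n) {f φ : En n → ℝ} (hf : LocallyIntegrable f volume)
    (hφ : ContDiff ℝ (⊤ : ℕ∞) φ) (hc : HasCompactSupport φ) :
    pd i (realConv f φ) = realConv f (pd i φ) := by
  ext x
  have h1 := hc.hasFDerivAt_convolution_right (ContinuousLinearMap.mul ℝ ℝ) hf
    (hφ.of_le (by exact_mod_cast le_top)) x
  unfold pd
  rw [realConv_eq, h1.fderiv, convolution_precompR_apply _ hf (hc.fderiv ℝ)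
    (hφ.continuous_fderiv (by simp))]
  rfl

theorem pdList_realConv {n : ℕ} (L : List (Fin n)) {f φ : En n → ℝ}
    (hf : LocallyIntegrable f volume) (hφ : ContDiff ℝ (⊤ : ℕ∞) φ) (hc : HasCompactSupport φ) :
    pdList L (realConv f φ) = realConv f (pdList L φ) := by
  induction L with
  | nil => rfl
  | cons i L ih =>
    exact (congrArg (pd i) ih).trans
      (pd_realConv i hf (contDiff_pdList L hφ) (hasCompactSupport_pdList L hc))

theorem mpd_realConv {n m : ℕ} {f φ : En n → ℝ} {g : (Fin n → ℕ) → En n → ℝ}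
    (hf : LocallyIntegrable f volume) (hg : HasWeakDerivs m f g)
    (hφ : ContDiff ℝ (⊤ : ℕ∞) φ) (hc : HasCompactSupport φ) {α : Fin n → ℕ} (hα : ∑ i, α i = m) :
    mpd α (realConv f φ) = realConv (g α) φ := by
  rw [mpd_eq_pdList, pdList_realConv _ hf hφ hc, ← mpd_eq_pdList]
  ext x
  have hcx : HasCompactSupport fun y => φ (x - y) :=
    hc.comp_homeomorph (Homeomorph.subLeft x)
  have h := hg.2 α hα (fun y => φ (x - y)) (hφ.comp (by fun_prop)) hcx
  rw [mpd_comp_const_sub α hφ, hα] at h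
  have h1 : ((-1 : ℝ) ^ m) * ∫ y, f y * mpd α φ (x - y) =
      (-1) ^ m * ∫ y, g α y * φ (x - y) := by
    rw [← h, ← integral_const_mul]
    refine integral_congr_ae (Eventually.of_forall fun y => ?_)
    ring
  exact mul_left_cancel₀ (pow_ne_zero m (by norm_num)) h1

theorem finite_setOf_sum_eq (n m : ℕ) : {α : Fin n → ℕ | ∑ i, α i = m}.Finite := by
  refine (Set.Finite.pi' fun _ => Set.finite_Iic m).subset fun α hα i => ?_
  exact (Finset.single_le_sum (f := α) (fun _ _ => Nat.zero_le _) (Finset.mem_univ i)).trans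
    (le_of_eq hα)

theorem abs_le_gradLen {n m : ℕ} (g : (Fin n → ℕ) → En n → ℝ) {α : Fin n → ℕ}
    (hα : ∑ i, α i = m) (x : En n) : |g α x| ≤ gradLen m g x := by
  refine Real.abs_le_sqrt ?_
  have hsum : Summable fun α : Fin n → ℕ => if (∑ i, α i) = m then (g α x) ^ 2 else 0 := by
    refine summable_of_hasFiniteSupport ((finite_setOf_sum_eq n m).subset fun β hβ => ?_)
    by_contra h
    exact hβ (if_neg h)
  have := hsum.le_tsum α fun β _ => by split_ifs <;> positivity
  rwa [if_pos hα] at this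

theorem enorm_le_ofReal_gradLen {n m : ℕ} (g : (Fin n → ℕ) → En n → ℝ) {α : Fin n → ℕ}
    (hα : ∑ i, α i = m) (x : En n) : ‖g α x‖ₑ ≤ ENNReal.ofReal (gradLen m g x) := by
  rw [Real.enorm_eq_ofReal_abs]
  exact ENNReal.ofReal_le_ofReal (abs_le_gradLen g hα x)

theorem exists_measurable_majorant {n m : ℕ} {g : (Fin n → ℕ) → En n → ℝ}
    (hg : ∀ α : Fin n → ℕ, ∑ i, α i = m → LocallyIntegrable (g α) volume) :
    ∃ F : En n → ℝ≥0∞, Measurable F ∧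
      (∀ α : Fin n → ℕ, ∑ i, α i = m → ∀ᵐ x, ‖g α x‖ₑ ≤ F x) ∧
      ∀ᵐ x, F x ≤ ENNReal.ofReal (gradLen m g x) := by
  have hm : ∀ α : {α : Fin n → ℕ // ∑ i, α i = m}, AEStronglyMeasurable (g α.1) volume :=
    fun α => (hg α.1 α.2).aestronglyMeasurable
  refine ⟨fun x => ⨆ α, ‖(hm α).mk _ x‖ₑ,
    Measurable.iSup fun α => (hm α).stronglyMeasurable_mk.measurable.enorm, fun α hα => ?_, ?_⟩
  · filter_upwards [(hm ⟨α, hα⟩).ae_eq_mk] with x hx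
    rw [show g α x = _ from hx]
    exact le_iSup (fun α => ‖(hm α).mk _ x‖ₑ) ⟨α, hα⟩
  · filter_upwards [ae_all_iff.2 fun α => (hm α).ae_eq_mk] with x hx
    refine iSup_le fun α => ?_
    rw [← hx α]
    exact enorm_le_ofReal_gradLen g α.2 x

theorem enorm_realConv_le {n : ℕ} {g φ : En n → ℝ} {F : En n → ℝ≥0∞}
    (hF : ∀ᵐ x, ‖g x‖ₑ ≤ F x) (x : En n) :
    ‖realConv g φ x‖ₑ ≤ ∫⁻ t, ‖φ (x - t)‖ₑ * F t := by
  refine (enorm_integral_le_lintegral_enorm _).trans (lintegral_mono_ae ?_)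
  filter_upwards [hF] with t ht
  rw [enorm_mul, mul_comm]
  exact mul_le_mul' le_rfl ht

theorem lintegral_conv_rpow_le {n : ℕ} {p : ℝ} (hp : 1 ≤ p) {w F : En n → ℝ≥0∞}
    (hw : Measurable w) (hF : Measurable F) (hw1 : ∫⁻ x, w x = 1) :
    ∫⁻ x, (∫⁻ t, w (x - t) * F t) ^ p ≤ ∫⁻ x, F x ^ p := by
  have hm : Measurable fun z : En n × En n => w (z.1 - z.2) * F z.2 ^ p :=
    (hw.comp (by fun_prop)).mul ((hF.pow_const p).comp measurable_snd)
  calc ∫⁻ x, (∫⁻ t, w (x - t) * F t) ^ p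
      ≤ ∫⁻ x, ∫⁻ t, w (x - t) * F t ^ p := by
        refine lintegral_mono fun x => ?_
        refine (rpow_lintegral_mul_le hp (w := fun t => w (x - t))
          (hw.comp (by fun_prop)).aemeasurable hF.aemeasurable).trans ?_
        rw [lintegral_sub_left_eq_self w x, hw1, ENNReal.one_rpow, one_mul]
    _ = ∫⁻ t, ∫⁻ x, w (x - t) * F t ^ p := lintegral_lintegral_swap hm.aemeasurable
    _ = ∫⁻ t, F t ^ p := by
        refine lintegral_congr fun t => ?_
        rw [lintegral_mul_const (f := fun x => w (x - t)) _ (hw.comp (by fun_prop)),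
          lintegral_sub_right_eq_self w t, hw1, one_mul]

/-- The Gagliardo-Nirenberg type estimate for mollified functions. -/
theorem exists_gagliardoNirenberg_realConv {n k : ℕ} (hn : 0 < n) (hk : 0 < k) {p γ s : ℝ}
    (hp : 1 ≤ p) (hγ : γ ∈ Gam p 1) (hs : s ∈ Ioo (0 : ℝ) 1) :
    ∃ C : ℝ, 0 < C ∧ ∀ (f φ : En n → ℝ) (g₁ g₂ : (Fin n → ℕ) → En n → ℝ),
      LocallyIntegrable f volume → HasWeakDerivs (k - 1) f g₁ → HasWeakDerivs k f g₂ →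
      essSup (fun x => ENNReal.ofReal (gradLen (k - 1) g₁ x)) volume < ⊤ →
      ContDiff ℝ (⊤ : ℕ∞) φ → HasCompactSupport φ → ∫⁻ x, ‖φ x‖ₑ = 1 →
      ∀ lam : ℝ, 0 < lam → ENNReal.ofReal lam *
          (∫⁻ x, innerInt k k lam (γ / (1 / s) + s - 1) γ (realConv f φ) x ^ p) ^
            (1 / (p * (1 / s))) ≤
        ENNReal.ofReal C * essSup (fun x => ENNReal.ofReal (gradLen (k - 1) g₁ x)) volume ^ (1 - s)
          * gradLp p k g₂ ^ s := by
  have hp0 : 0 < p := by linarith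
  obtain ⟨C, hC, hest⟩ := exists_gagliardoNirenberg_smooth hn hk hp hγ hs
  refine ⟨C, hC, fun f φ g₁ g₂ hf hg₁ hg₂ htop hφ hc hφ1 lam hlam => ?_⟩
  set A := essSup (fun x => ENNReal.ofReal (gradLen (k - 1) g₁ x)) volume with hA
  obtain ⟨F, hF, hgF, hFg⟩ := exists_measurable_majorant hg₂.1
  have hφm : Measurable fun x => ‖φ x‖ₑ := hφ.continuous.measurable.enorm
  set Fφ : En n → ℝ≥0∞ := fun x => ∫⁻ t, ‖φ (x - t)‖ₑ * F t with hFφ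
  have hFφm : Measurable Fφ := by
    have hm : Measurable fun z : En n × En n => ‖φ (z.1 - z.2)‖ₑ * F z.2 :=
      (hφm.comp (by fun_prop)).mul (hF.comp measurable_snd)
    exact hm.lintegral_prod_right'
  have hbound := hest (realConv f φ) Fφ A.toReal (contDiff_realConv hf hφ hc) hFφm
    ENNReal.toReal_nonneg (fun x α hα => ?_) (fun x α hα => ?_) lam hlam
  · rw [ENNReal.ofReal_toReal htop.ne] at hbound
    refine hbound.trans ?_
    gcongr ENNReal.ofReal C * _ * ?_ ^ s
    · exact hs.1.le
    · refine ENNReal.rpow_le_rpow ((lintegral_conv_rpow_le hp hφm hF hφ1).trans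
        (lintegral_mono_ae ?_)) (by positivity)
      filter_upwards [hFg] with x hx
      rw [← ENNReal.ofReal_rpow_of_nonneg (p := p) (x := gradLen k g₂ x) (Real.sqrt_nonneg _) hp0.le]
      exact ENNReal.rpow_le_rpow hx hp0.le
  · rw [mpd_realConv hf hg₂ hφ hc hα]
    exact enorm_realConv_le (hgF α hα) x
  · rw [mpd_realConv hf hg₁ hφ hc hα]
    have h1 : ∀ᵐ t, ‖g₁ α t‖ₑ ≤ A := by
      filter_upwards [ENNReal.ae_le_essSup
        (fun x => ENNReal.ofReal (gradLen (k - 1) g₁ x))] with t ht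
      exact (enorm_le_ofReal_gradLen g₁ hα t).trans ht
    have h2 := enorm_realConv_le (φ := φ) h1 x
    rw [lintegral_mul_const (f := fun t => ‖φ (x - t)‖ₑ) _ (hφm.comp (by fun_prop)),
      lintegral_sub_left_eq_self (fun t => ‖φ t‖ₑ) x, hφ1, one_mul, Real.enorm_eq_ofReal_abs] at h2
    exact (ENNReal.ofReal_le_iff_le_toReal htop.ne).1 h2

theorem tendsto_kDiff {n : ℕ} (k : ℕ) {F : ℕ → En n → ℝ} {f : En n → ℝ} {x h : En n}
    (hF : ∀ j : ℕ, Tendsto (fun i => F i (x + (j : ℝ) • h)) atTop (𝓝 (f (x + (j : ℝ) • h)))) :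
    Tendsto (fun i => kDiff k (F i) h x) atTop (𝓝 (kDiff k f h x)) :=
  tendsto_finsetSum _ fun j _ => (hF j).const_mul _

theorem ae_forall_add_natCast_smul {n : ℕ} {P : En n → Prop} (hP : ∀ᵐ y, P y) {x : En n}
    (hx : P x) : ∀ᵐ h : En n, ∀ j : ℕ, P (x + (j : ℝ) • h) := by
  refine ae_all_iff.2 fun j => ?_
  rcases j with _ | j
  · simpa using hx
  have h1 : volume ((fun y => x + y) ⁻¹' {y | ¬ P y}) = 0 := by
    rw [measure_preimage_add]
    exact hP
  have h2 := Measure.addHaar_preimage_smul (volume : Measure (En n))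
    (r := ((j + 1 : ℕ) : ℝ)) (by positivity) ((fun y => x + y) ⁻¹' {y | ¬ P y})
  rw [h1, mul_zero] at h2
  exact h2

theorem innerInt_le_liminf {n k ℓ : ℕ} {lam b γ : ℝ} {F : ℕ → En n → ℝ} {f : En n → ℝ}
    (hF : ∀ i, Continuous (F i)) {x : En n}
    (hconv : ∀ᵐ h : En n, ∀ j : ℕ,
      Tendsto (fun i => F i (x + (j : ℝ) • h)) atTop (𝓝 (f (x + (j : ℝ) • h)))) :
    innerInt k ℓ lam b γ f x ≤ liminf (fun i => innerInt k ℓ lam b γ (F i) x) atTop := by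
  refine le_trans (lintegral_mono_ae ?_) (lintegral_liminf_le fun i =>
    (measurable_memE_weight k ℓ lam b γ (hF i)).comp measurable_prodMk_left)
  filter_upwards [hconv] with h hh
  by_cases hE : memE k ℓ lam b f x h
  · rw [if_pos hE]
    refine le_liminf_of_le (by isBoundedDefault) ?_
    filter_upwards [(tendsto_kDiff k hh).abs.eventually_const_lt hE.2] with i hi
    have hEi : memE k ℓ lam b (F i) x h := ⟨hE.1, hi⟩
    simp [hEi]
  · simp [hE]

theorem lintegral_innerInt_rpow_le_liminf {n k ℓ : ℕ} {lam b γ p : ℝ} (hp : 0 < p)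
    {F : ℕ → En n → ℝ} {f : En n → ℝ} (hF : ∀ i, Continuous (F i))
    (hconv : ∀ᵐ x, Tendsto (fun i => F i x) atTop (𝓝 (f x))) :
    ∫⁻ x, innerInt k ℓ lam b γ f x ^ p ≤
      liminf (fun i => ∫⁻ x, innerInt k ℓ lam b γ (F i) x ^ p) atTop := by
  refine le_trans (lintegral_mono_ae ?_) (lintegral_liminf_le fun i =>
    (measurable_innerInt k ℓ lam b γ (hF i)).pow_const p)
  filter_upwards [hconv] with x hx
  refine (ENNReal.rpow_le_rpow
    (innerInt_le_liminf hF (ae_forall_add_natCast_smul hconv hx)) hp.le).trans (le_of_eq ?_)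
  exact (ENNReal.orderIsoRpow p hp).liminf_apply

/-- A sequence of mollifiers approximating every locally integrable function almost everywhere. -/
theorem exists_mollifiers (n : ℕ) : ∃ φ : ℕ → En n → ℝ,
    (∀ i, ContDiff ℝ (⊤ : ℕ∞) (φ i) ∧ HasCompactSupport (φ i) ∧ ∫⁻ x, ‖φ i x‖ₑ = 1) ∧
    ∀ f : En n → ℝ, LocallyIntegrable f volume →
      ∀ᵐ x, Tendsto (fun i => realConv f (φ i) x) atTop (𝓝 (f x)) := by
  set ψ : ℕ → ContDiffBump (0 : En n) := fun i =>
    ⟨1 / ((i : ℝ) + 1), 2 * (1 / ((i : ℝ) + 1)), by positivity, by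
      have : 0 < 1 / ((i : ℝ) + 1) := by positivity
      linarith⟩ with hψ
  refine ⟨fun i => (ψ i).normed volume, fun i => ⟨(ψ i).contDiff_normed,
    (ψ i).hasCompactSupport_normed, ?_⟩, fun f hf => ?_⟩
  · have h1 := ofReal_integral_eq_lintegral_ofReal ((ψ i).integrable_normed (μ := volume))
      (Eventually.of_forall fun x => (ψ i).nonneg_normed x)
    rw [(ψ i).integral_normed, ENNReal.ofReal_one] at h1
    rw [h1]
    exact lintegral_congr fun x => Real.enorm_of_nonneg ((ψ i).nonneg_normed x)
  · have h0 : Tendsto (fun i => (ψ i).rOut) atTop (𝓝 0) := by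
      simpa [hψ] using (tendsto_one_div_add_atTop_nhds_zero_nat (𝕜 := ℝ)).const_mul 2
    filter_upwards [ContDiffBump.ae_convolution_tendsto_right_of_locallyIntegrable
      (K := 2) h0 (Eventually.of_forall fun i => le_rfl) hf] with x hx
    refine hx.congr fun i => ?_
    rw [convolution_lsmul_swap]
    exact integral_congr_ae (Eventually.of_forall fun t => by simp [mul_comm])

/-- fractional Gagliardo–Nirenberg-type inequality, case `q₀ = ∞`,
`q = 1/s`. -/
theorem statement16 (n k : ℕ) (hn : 0 < n) (hk : 0 < k) (p γ s : ℝ)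
    (hp : 1 ≤ p) (hγ : γ ∈ Gam p 1) (hs : s ∈ Ioo (0 : ℝ) 1) (q : ℝ) (hq : q = 1 / s) :
    ∃ C : ℝ, 0 < C ∧
      ∀ (f : En n → ℝ) (g₁ g₂ : (Fin n → ℕ) → En n → ℝ),
        LocallyIntegrable f volume →
        HasWeakDerivs (k - 1) f g₁ → HasWeakDerivs k f g₂ →
        essSup (fun x => ENNReal.ofReal (gradLen (k - 1) g₁ x)) volume < ⊤ →
        gradLp p k g₂ < ⊤ →
        (⨆ lam ∈ Ioi (0 : ℝ), ENNReal.ofReal lam *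
            (∫⁻ x, (innerInt k k lam (γ / q + s - 1) γ f x) ^ p) ^ (1 / (p * q)))
          ≤ ENNReal.ofReal C *
              (essSup (fun x => ENNReal.ofReal (gradLen (k - 1) g₁ x)) volume) ^ (1 - s)
              * gradLp p k g₂ ^ s := by
  subst hq
  have hp0 : 0 < p := by linarith
  have hs0 : 0 < s := hs.1
  obtain ⟨C, hC, hest⟩ := exists_gagliardoNirenberg_realConv hn hk hp hγ hs
  obtain ⟨φ, hφ, hlim⟩ := exists_mollifiers n
  refine ⟨C, hC, fun f g₁ g₂ hf hg₁ hg₂ htop _ => iSup₂_le fun lam hlam => ?_⟩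
  have hlam : 0 < lam := hlam
  have he : 0 < 1 / (p * (1 / s)) := by positivity
  have hl0 : ENNReal.ofReal lam ≠ 0 := (ENNReal.ofReal_pos.2 hlam).ne'
  rw [mul_comm (ENNReal.ofReal lam), ← ENNReal.le_div_iff_mul_le (Or.inl hl0)
    (Or.inl ENNReal.ofReal_ne_top), ← ENNReal.le_rpow_inv_iff he]
  refine (lintegral_innerInt_rpow_le_liminf hp0
    (fun i => (contDiff_realConv hf (hφ i).1 (hφ i).2.1).continuous) (hlim f hf)).trans ?_
  refine (liminf_le_liminf (Eventually.of_forall fun i => ?_)).trans_eq (liminf_const _)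
  rw [ENNReal.le_rpow_inv_iff he, ENNReal.le_div_iff_mul_le (Or.inl hl0)
    (Or.inl ENNReal.ofReal_ne_top), mul_comm]
  exact hest f (φ i) g₁ g₂ hf hg₁ hg₂ htop (hφ i).1 (hφ i).2.1 (hφ i).2.2 lam hlam
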